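/- arXiv:1412.8295 — 2 statements merged into one kernel-verified Lean document; each statement's English description precedes it below -/
import Mathlib

section
/- Suppose $c_1=c_2=2$. For every $q\in\mathbb{R}$ there is a constant $C_0>1$ such that for $\nu_q$-almost every $x\in[0,1]$, for all sufficiently large $n$, $C_0^{-(\sqrt n+1)}\le\nu(I_n(x))/\nu(I_n(x)^+)\le C_0^{\sqrt n+1}$ and $C_0^{-(\sqrt n+1)}\le\nu(I_n(x))/\nu(I_n(x)^-)\le C_0^{\sqrt n+1}$. -/
open MeasureTheory Metric Set Filter Topology Classical
open scoped ENNReal NNReal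

noncomputable section

namespace MF

/-! ### Olsen's multifractal measures and dimension functions on a metric space -/

variable {X : Type} [MetricSpace X]

/-- The sum `∑ m(B(xᵢ,rᵢ))^q (2rᵢ)^t` associated with a countable family of centered balls. -/
def olsenSum [MeasurableSpace X] (m : Measure X) (q t : ℝ) {ι : Type}
    (c : ι → X) (r : ι → ℝ) : ℝ≥0∞ :=
  ∑' i, m (closedBall (c i) (r i)) ^ q * ENNReal.ofReal (2 * r i) ^ t

/-- `Olsen's 𝓗^{q,t}_{m,δ}`: infimum over countable centered `δ`-coverings of `E`. -/
def Hdel [MeasurableSpace X] (m : Measure X) (q t δ : ℝ) (E : Set X) : ℝ≥0∞ :=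
  ⨅ (ι : Type) (_ : Countable ι) (c : ι → X) (r : ι → ℝ)
    (_ : ∀ i, c i ∈ E) (_ : ∀ i, 0 < r i ∧ r i ≤ δ)
    (_ : E ⊆ ⋃ i, closedBall (c i) (r i)), olsenSum m q t c r

/-- Olsen's premeasure `𝓗̄^{q,t}_m` (limit, i.e. supremum, as `δ ↓ 0`). -/
def Hpre [MeasurableSpace X] (m : Measure X) (q t : ℝ) (E : Set X) : ℝ≥0∞ :=
  ⨆ (δ : ℝ) (_ : 0 < δ), Hdel m q t δ E

/-- Olsen's multifractal Hausdorff measure `𝓗^{q,t}_m`. -/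
def Hmeas [MeasurableSpace X] (m : Measure X) (q t : ℝ) (E : Set X) : ℝ≥0∞ :=
  ⨆ (F : Set X) (_ : F ⊆ E), Hpre m q t F

/-- `𝓟̄^{q,t}_{m,δ}`: supremum over countable centered `δ`-packings of `E`. -/
def Pdel [MeasurableSpace X] (m : Measure X) (q t δ : ℝ) (E : Set X) : ℝ≥0∞ :=
  ⨆ (ι : Type) (_ : Countable ι) (c : ι → X) (r : ι → ℝ)
    (_ : ∀ i, c i ∈ E) (_ : ∀ i, 0 < r i ∧ r i ≤ δ)
    (_ : ∀ i j, i ≠ j → Disjoint (closedBall (c i) (r i)) (closedBall (c j) (r j))),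
    olsenSum m q t c r

/-- Olsen's packing premeasure `𝓟̄^{q,t}_m` (limit, i.e. infimum, as `δ ↓ 0`). -/
def Ppre [MeasurableSpace X] (m : Measure X) (q t : ℝ) (E : Set X) : ℝ≥0∞ :=
  ⨅ (δ : ℝ) (_ : 0 < δ), Pdel m q t δ E

/-- Olsen's multifractal packing measure `𝓟^{q,t}_m`. -/
def Pmeas [MeasurableSpace X] (m : Measure X) (q t : ℝ) (E : Set X) : ℝ≥0∞ :=
  ⨅ (En : ℕ → Set X) (_ : E ⊆ ⋃ n, En n), ∑' n, Ppre m q t (En n)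

/-- The (topological) support of a measure on a metric space. -/
def msupport [MeasurableSpace X] (m : Measure X) : Set X :=
  {x | ∀ r : ℝ, 0 < r → 0 < m (ball x r)}

/-- Olsen's multifractal Hausdorff dimension function `b_m`. -/
def bFun [MeasurableSpace X] (m : Measure X) (q : ℝ) : ℝ :=
  sInf {t | Hmeas m q t (msupport m) = 0}

/-- Olsen's multifractal packing dimension function `B_m`. -/
def BFun [MeasurableSpace X] (m : Measure X) (q : ℝ) : ℝ :=
  sInf {t | Pmeas m q t (msupport m) = 0}

/-- Olsen's function `τ_m`. -/
def tauFun [MeasurableSpace X] (m : Measure X) (q : ℝ) : ℝ :=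
  sInf {t | Ppre m q t (msupport m) = 0}

/-- `t`-dimensional packing pre-premeasure at scale `δ`. -/
def pPdel (t δ : ℝ) (E : Set X) : ℝ≥0∞ :=
  ⨆ (ι : Type) (_ : Countable ι) (c : ι → X) (r : ι → ℝ)
    (_ : ∀ i, c i ∈ E) (_ : ∀ i, 0 < r i ∧ r i ≤ δ)
    (_ : ∀ i j, i ≠ j → Disjoint (closedBall (c i) (r i)) (closedBall (c j) (r j))),
    ∑' i, ENNReal.ofReal (2 * r i) ^ t

/-- `t`-dimensional packing premeasure. -/
def pPpre (t : ℝ) (E : Set X) : ℝ≥0∞ := ⨅ (δ : ℝ) (_ : 0 < δ), pPdel t δ E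

/-- `t`-dimensional packing measure. -/
def pPmeas (t : ℝ) (E : Set X) : ℝ≥0∞ :=
  ⨅ (En : ℕ → Set X) (_ : E ⊆ ⋃ n, En n), ∑' n, pPpre t (En n)

/-- Packing dimension of a set. -/
def packDim (E : Set X) : ℝ := sInf {t | pPmeas t E = 0}

/-- The level set `X_m(α)` of points of the support where the local Hölder exponent is `α`. -/
def Xlev [MeasurableSpace X] (m : Measure X) (α : ℝ) : Set X :=
  {x | x ∈ msupport m ∧
    Tendsto (fun r => Real.log (m (closedBall x r)).toReal / Real.log r)
      (𝓝[>] (0 : ℝ)) (𝓝 α)}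

/-- Legendre transform `f^*(x) = inf_y (xy + f(y))`. -/
def leg (f : ℝ → ℝ) (x : ℝ) : ℝ := ⨅ y : ℝ, (x * y + f y)

/-! ### The mixed symbolic space and inhomogeneous multinomial measures -/

/-- `j` is an index governed by the first alphabet:
`T (2k-1) ≤ j < T (2k)` for some `k ≥ 1`. -/
def isA (T : ℕ → ℕ) (j : ℕ) : Prop :=
  ∃ k, 1 ≤ k ∧ T (2 * k - 1) ≤ j ∧ j < T (2 * k)

/-- The size of the alphabet at (0-based) position `n`, i.e. at paper index `j = n+1`. -/
def Yc (c₁ c₂ : ℕ) (T : ℕ → ℕ) (n : ℕ) : ℕ := if isA T (n + 1) then c₁ else c₂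

/-- The mixed symbolic space `∂𝒜₁,₂* = ∏ⱼ Yⱼ`. -/
abbrev Omg (c₁ c₂ : ℕ) (T : ℕ → ℕ) : Type := ∀ n : ℕ, Fin (Yc c₁ c₂ T n)

/-- Finite words of length `n`. -/
abbrev Word (c₁ c₂ : ℕ) (T : ℕ → ℕ) (n : ℕ) : Type :=
  ∀ i : Fin n, Fin (Yc c₁ c₂ T i.val)

/-- `N_n`: the number of indices `1 ≤ j ≤ n` governed by the first alphabet. -/
def Ncount (T : ℕ → ℕ) (n : ℕ) : ℕ := ((Finset.Icc 1 n).filter (isA T)).card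

/-- Diameter `c₁^{-N_n} c₂^{-(n-N_n)}` of a cylinder of generation `n`. -/
def Dw (c₁ c₂ : ℕ) (T : ℕ → ℕ) (n : ℕ) : ℝ :=
  ((c₁ : ℝ) ^ Ncount T n * (c₂ : ℝ) ^ (n - Ncount T n))⁻¹

/-- The cylinder `[w]` defined by a finite word `w`. -/
def cyl (c₁ c₂ : ℕ) (T : ℕ → ℕ) (n : ℕ) (w : Word c₁ c₂ T n) : Set (Omg c₁ c₂ T) :=
  {x | ∀ i : Fin n, x i.val = w i}

/-- The mass `∏_{j≤n} p_j` given to the cylinder `[w]` by the inhomogeneous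
multinomial measure with weights `a` and `b`. -/
def cylWeight (c₁ c₂ : ℕ) (T : ℕ → ℕ) (a b : ℕ → ℝ) (n : ℕ) (w : Word c₁ c₂ T n) : ℝ :=
  ∏ i : Fin n, (if isA T (i.val + 1) then a (w i).val else b (w i).val)

/-- `θ(q) = log_c (p₁^q + ⋯ + p_c^q)`. -/
def theta (c : ℕ) (p : ℕ → ℝ) (q : ℝ) : ℝ :=
  Real.logb c (∑ i ∈ Finset.range c, p i ^ q)

/-- `τ_{μ,n}(q)`, defined by `∑_{z ∈ 𝒜₁,₂ⁿ} μ([z])^q = |w|^{-τ_{μ,n}(q)}`. -/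
def tauN (c₁ c₂ : ℕ) (T : ℕ → ℕ) (a b : ℕ → ℝ) (q : ℝ) (n : ℕ) : ℝ :=
  Real.log (∑ z : Word c₁ c₂ T n, cylWeight c₁ c₂ T a b n z ^ q) /
    Real.log ((c₁ : ℝ) ^ Ncount T n * (c₂ : ℝ) ^ (n - Ncount T n))

/-- The natural projection `γ : ∂𝒜₁,₂* → [0,1]`,
`γ(ε₁ε₂⋯) = ∑_{n≥1} εₙ c₁^{-N_n} c₂^{-(n-N_n)}`. -/
def gammaMap (c₁ c₂ : ℕ) (T : ℕ → ℕ) (x : Omg c₁ c₂ T) : ℝ :=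
  ∑' n : ℕ, ((x n).val : ℝ) * Dw c₁ c₂ T (n + 1)

/-- The normalized weights `pᵢ^q / (p₁^q + ⋯ + p_c^q)`. -/
def taW (c : ℕ) (p : ℕ → ℝ) (q : ℝ) (i : ℕ) : ℝ :=
  p i ^ q / ∑ j ∈ Finset.range c, p j ^ q

/-- `s₁ = min{max aᵢ, max bⱼ}`. -/
def sOne (c₁ c₂ : ℕ) (a b : ℕ → ℝ) : ℝ :=
  min (sSup {x | ∃ i < c₁, a i = x}) (sSup {x | ∃ j < c₂, b j = x})

/-- `s₂ = max{min aᵢ, min bⱼ}`. -/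
def sTwo (c₁ c₂ : ℕ) (a b : ℕ → ℝ) : ℝ :=
  max (sInf {x | ∃ i < c₁, a i = x}) (sInf {x | ∃ j < c₂, b j = x})

/-- Entropy `h(p) = -∑_{i<2} pᵢ log₂ pᵢ`. -/
def hEnt (p : ℕ → ℝ) : ℝ := -(∑ i ∈ Finset.range 2, p i * Real.logb 2 (p i))

/-! ### Dyadic intervals -/

/-- The family `𝓕_n` of dyadic intervals of generation `n` in `[0,1]`. -/
def Fnfam (n : ℕ) : Set (Set ℝ) :=
  {I | ∃ j : ℕ, j < 2 ^ n ∧ I = Set.Icc ((j : ℝ) / 2 ^ n) (((j : ℝ) + 1) / 2 ^ n)}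

/-- Index of the dyadic interval of generation `n` containing `x`
(the left one when `x` is dyadic). -/
def dyadIdx (n : ℕ) (x : ℝ) : ℤ := ⌈x * 2 ^ n⌉ - 1

/-- `I_n(x)`: the dyadic interval of generation `n` containing `x`
(the left one when `x` is dyadic). -/
def Idyad (n : ℕ) (x : ℝ) : Set ℝ :=
  Set.Icc ((dyadIdx n x : ℝ) / 2 ^ n) (((dyadIdx n x : ℝ) + 1) / 2 ^ n)

/-- `I_n(x)⁺`: the right neighbour of `I_n(x)` in `𝓕_n`. -/
def IdyadP (n : ℕ) (x : ℝ) : Set ℝ :=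
  Set.Icc (((dyadIdx n x : ℝ) + 1) / 2 ^ n) (((dyadIdx n x : ℝ) + 2) / 2 ^ n)

/-- `I_n(x)⁻`: the left neighbour of `I_n(x)` in `𝓕_n`. -/
def IdyadM (n : ℕ) (x : ℝ) : Set ℝ :=
  Set.Icc (((dyadIdx n x : ℝ) - 1) / 2 ^ n) ((dyadIdx n x : ℝ) / 2 ^ n)

/-- The integer `∑_{i<n} x_i 2^{n-1-i}` read off from the first `n` binary digits of `x`. -/
def binPrefix {T : ℕ → ℕ} (x : Omg 2 2 T) : ℕ → ℕ
  | 0 => 0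
  | n + 1 => 2 * binPrefix x n + (x n).val

/-- The product of the weights `p i ε_i` over the `n` binary digits `ε_i` of `j`. -/
def binWeight (p : ℕ → ℕ → ℝ) : ℕ → ℕ → ℝ
  | 0, _ => 1
  | n + 1, j => binWeight p n (j / 2) * p n (j % 2)

/-- The weights of the digit in position `n` of an inhomogeneous multinomial measure. -/
def digitWeight (T : ℕ → ℕ) (a b : ℕ → ℝ) (n e : ℕ) : ℝ :=
  if isA T (n + 1) then a e else b e

lemma Yc_two (T : ℕ → ℕ) (n : ℕ) : Yc 2 2 T n = 2 := by
  simp [Yc]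

lemma digit_lt_two {T : ℕ → ℕ} (x : Omg 2 2 T) (n : ℕ) : (x n).val < 2 :=
  (x n).isLt.trans_eq (Yc_two T n)

lemma Dw_two (T : ℕ → ℕ) (n : ℕ) : Dw 2 2 T n = ((2 : ℝ) ^ n)⁻¹ := by
  have h : Ncount T n ≤ n := by
    simpa [Ncount] using Finset.card_filter_le (Finset.Icc 1 n) (isA T)
  simp only [Dw, Nat.cast_ofNat]
  rw [← pow_add, Nat.add_sub_cancel' h]

lemma binPrefix_lt {T : ℕ → ℕ} (x : Omg 2 2 T) (n : ℕ) : binPrefix x n < 2 ^ n := by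
  induction n with
  | zero => simp [binPrefix]
  | succ n ih =>
    have := digit_lt_two x n
    rw [binPrefix, pow_succ]
    omega

lemma measurable_binPrefix {T : ℕ → ℕ} (n : ℕ) :
    Measurable fun x : Omg 2 2 T => binPrefix x n := by
  induction n with
  | zero => exact measurable_const
  | succ n ih =>
    have h : Measurable fun x : Omg 2 2 T => (x n).val :=
      (measurable_of_finite (fun i : Fin (Yc 2 2 T n) => i.val)).comp (measurable_pi_apply n)
    exact (measurable_const.mul ih).add h

lemma sum_digits_eq {T : ℕ → ℕ} (x : Omg 2 2 T) (n : ℕ) :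
    ∑ i ∈ Finset.range n, ((x i).val : ℝ) * Dw 2 2 T (i + 1) = binPrefix x n / 2 ^ n := by
  induction n with
  | zero => simp [binPrefix]
  | succ n ih =>
    rw [Finset.sum_range_succ, ih, Dw_two, binPrefix]
    push_cast
    field_simp
    ring

lemma summable_digits {T : ℕ → ℕ} (x : Omg 2 2 T) :
    Summable fun n : ℕ => ((x n).val : ℝ) * Dw 2 2 T (n + 1) := by
  refine Summable.of_nonneg_of_le (fun n => ?_) (fun n => ?_) summable_geometric_two
  · rw [Dw_two]; positivity
  · have h : ((x n).val : ℝ) ≤ 1 := by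
      exact_mod_cast Nat.lt_succ_iff.mp (digit_lt_two x n)
    have h2 : ((2 : ℝ) ^ (n + 1))⁻¹ ≤ (1 / 2) ^ n := by
      rw [one_div, inv_pow]
      gcongr
      · norm_num
      · omega
    rw [Dw_two]
    calc ((x n).val : ℝ) * ((2 : ℝ) ^ (n + 1))⁻¹ ≤ 1 * ((2 : ℝ) ^ (n + 1))⁻¹ := by gcongr
      _ ≤ _ := by rwa [one_mul]

lemma tendsto_binPrefix {T : ℕ → ℕ} (x : Omg 2 2 T) :
    Tendsto (fun n => (binPrefix x n : ℝ) / 2 ^ n) atTop (𝓝 (gammaMap 2 2 T x)) := by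
  simpa only [sum_digits_eq, gammaMap] using (summable_digits x).hasSum.tendsto_sum_nat

lemma measurable_gammaMap (T : ℕ → ℕ) : Measurable (gammaMap 2 2 T) := by
  refine measurable_of_tendsto_metrizable (f := fun n x => (binPrefix x n : ℝ) / 2 ^ n)
    (fun n => ?_) (tendsto_pi_nhds.mpr tendsto_binPrefix)
  exact (measurable_from_nat.comp (measurable_binPrefix n)).div_const _

lemma binPrefix_le_gammaMap {T : ℕ → ℕ} (x : Omg 2 2 T) (n : ℕ) :
    (binPrefix x n : ℝ) ≤ gammaMap 2 2 T x * 2 ^ n := by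
  rw [← div_le_iff₀ (by positivity), ← sum_digits_eq]
  exact (summable_digits x).sum_le_tsum _ fun i _ => by rw [Dw_two]; positivity

lemma gammaMap_le_binPrefix_add_one {T : ℕ → ℕ} (x : Omg 2 2 T) (n : ℕ) :
    gammaMap 2 2 T x * 2 ^ n ≤ binPrefix x n + 1 := by
  rw [← le_div_iff₀ (by positivity)]
  have hanti : Antitone fun n => ((binPrefix x n : ℝ) + 1) / 2 ^ n := by
    refine antitone_nat_of_succ_le fun n => ?_
    have h : ((x n).val : ℝ) ≤ 1 := by
      exact_mod_cast Nat.lt_succ_iff.mp (digit_lt_two x n)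
    rw [div_le_div_iff₀ (by positivity) (by positivity), binPrefix, pow_succ]
    push_cast
    have : (0 : ℝ) < 2 ^ n := by positivity
    nlinarith
  refine hanti.le_of_tendsto ?_ n
  have h0 : Tendsto (fun n : ℕ => ((2 : ℝ) ^ n)⁻¹) atTop (𝓝 0) := by
    exact tendsto_inv_atTop_zero.comp (tendsto_pow_atTop_atTop_of_one_lt one_lt_two)
  simpa [add_div] using (tendsto_binPrefix x).add h0

/-- If the expansion of `γ(x)` stopped at rank `n`, all further digits of `x` would vanish. -/
lemma binPrefix_add_of_eq {T : ℕ → ℕ} {x : Omg 2 2 T} {n : ℕ}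
    (h : gammaMap 2 2 T x * 2 ^ n = binPrefix x n) (l : ℕ) :
    gammaMap 2 2 T x * 2 ^ (n + l) = binPrefix x (n + l) ∧
      binPrefix x (n + l) = 2 ^ l * binPrefix x n := by
  induction l with
  | zero => simpa using h
  | succ l ih =>
    have h1 := binPrefix_le_gammaMap x (n + l + 1)
    have h2 : gammaMap 2 2 T x * 2 ^ (n + l + 1) = 2 * binPrefix x (n + l) := by
      rw [← ih.1]; ring
    have hd : (x (n + l)).val = 0 := by
      rw [h2, binPrefix] at h1
      have : 2 * binPrefix x (n + l) + (x (n + l)).val ≤ 2 * binPrefix x (n + l) := by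
        exact_mod_cast h1
      omega
    have h3 : binPrefix x (n + l + 1) = 2 * binPrefix x (n + l) := by rw [binPrefix, hd, add_zero]
    refine ⟨?_, ?_⟩
    · rw [← add_assoc, h2, h3]; push_cast; rfl
    · rw [← add_assoc, h3, ih.2]; ring

/-- If `γ(x)` were the right end point of its `n`-th dyadic interval,
all further digits of `x` would equal one. -/
lemma binPrefix_add_of_eq_add_one {T : ℕ → ℕ} {x : Omg 2 2 T} {n : ℕ}
    (h : gammaMap 2 2 T x * 2 ^ n = binPrefix x n + 1) (l : ℕ) :
    gammaMap 2 2 T x * 2 ^ (n + l) = binPrefix x (n + l) + 1 ∧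
      binPrefix x (n + l) + 1 = 2 ^ l * (binPrefix x n + 1) := by
  induction l with
  | zero => simpa using h
  | succ l ih =>
    have h1 := gammaMap_le_binPrefix_add_one x (n + l + 1)
    have h2 : gammaMap 2 2 T x * 2 ^ (n + l + 1) = 2 * (binPrefix x (n + l) + 1) := by
      rw [← ih.1]; ring
    have hd : (x (n + l)).val = 1 := by
      rw [h2, binPrefix] at h1
      have : 2 * (binPrefix x (n + l) + 1) ≤ 2 * binPrefix x (n + l) + (x (n + l)).val + 1 := by
        exact_mod_cast h1
      have := digit_lt_two x (n + l)
      omega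
    have h3 : binPrefix x (n + l + 1) = 2 * binPrefix x (n + l) + 1 := by rw [binPrefix, hd]
    refine ⟨?_, ?_⟩
    · rw [← add_assoc, h2, h3]; push_cast; ring
    · rw [← add_assoc, h3, pow_succ]; linarith [ih.2]

/-- Along the prefixes of `x`, the last `√n` digits are eventually not all equal. -/
def EventuallyMixed {T : ℕ → ℕ} (x : Omg 2 2 T) : Prop :=
  ∀ᶠ n : ℕ in atTop, ¬ 2 ^ n.sqrt ∣ binPrefix x n ∧ ¬ 2 ^ n.sqrt ∣ binPrefix x n + 1

lemma EventuallyMixed.lt_gammaMap_lt {T : ℕ → ℕ} {x : Omg 2 2 T} (hx : EventuallyMixed x) (n : ℕ) :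
    (binPrefix x n : ℝ) < gammaMap 2 2 T x * 2 ^ n ∧
      gammaMap 2 2 T x * 2 ^ n < binPrefix x n + 1 := by
  obtain ⟨N, hN⟩ := eventually_atTop.mp hx
  obtain ⟨l, hl, hsqrt⟩ : ∃ l, N ≤ n + l ∧ (n + l).sqrt ≤ l := by
    refine ⟨N + n + 2, by omega, ?_⟩
    have : (n + (N + n + 2)).sqrt < N + n + 3 := Nat.sqrt_lt.mpr (by nlinarith)
    omega
  have hdvd := pow_dvd_pow 2 hsqrt
  constructor
  · refine lt_of_le_of_ne (binPrefix_le_gammaMap x n) fun h => (hN _ hl).1 ?_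
    rw [(binPrefix_add_of_eq h.symm l).2]
    exact hdvd.mul_right _
  · refine lt_of_le_of_ne (gammaMap_le_binPrefix_add_one x n) fun h => (hN _ hl).2 ?_
    rw [(binPrefix_add_of_eq_add_one h l).2]
    exact hdvd.mul_right _

lemma EventuallyMixed.dyadIdx_eq {T : ℕ → ℕ} {x : Omg 2 2 T} (hx : EventuallyMixed x) (n : ℕ) :
    dyadIdx n (gammaMap 2 2 T x) = binPrefix x n := by
  have h := hx.lt_gammaMap_lt n
  have : ⌈gammaMap 2 2 T x * 2 ^ n⌉ = (binPrefix x n : ℤ) + 1 := by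
    rw [Int.ceil_eq_iff]
    push_cast
    exact ⟨by linarith [h.1], h.2.le⟩
  rw [dyadIdx, this, add_sub_cancel_right]

lemma EventuallyMixed.mem_Icc_iff {T : ℕ → ℕ} {x : Omg 2 2 T} (hx : EventuallyMixed x) (n j : ℕ) :
    gammaMap 2 2 T x ∈ Icc ((j : ℝ) / 2 ^ n) (((j : ℝ) + 1) / 2 ^ n) ↔ binPrefix x n = j := by
  have h := hx.lt_gammaMap_lt n
  rw [mem_Icc, div_le_iff₀ (by positivity), le_div_iff₀ (by positivity)]
  constructor
  · rintro ⟨h1, h2⟩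
    have h3 : (j : ℝ) < binPrefix x n + 1 := h1.trans_lt h.2
    have h4 : (binPrefix x n : ℝ) < j + 1 := h.1.trans_le h2
    norm_cast at h3 h4
    omega
  · rintro rfl
    exact ⟨h.1.le, h.2.le⟩

lemma binPrefix_eq_iff {T : ℕ → ℕ} (x : Omg 2 2 T) (n j : ℕ) (hj : j < 2 ^ n) :
    binPrefix x n = j ↔ ∀ i < n, (x i).val = j / 2 ^ (n - 1 - i) % 2 := by
  induction n generalizing j with
  | zero => simp [binPrefix, Nat.lt_one_iff.mp hj]
  | succ n ih =>
    have hd := digit_lt_two x n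
    have h1 : binPrefix x (n + 1) = j ↔ binPrefix x n = j / 2 ∧ (x n).val = j % 2 := by
      rw [binPrefix]; omega
    rw [h1, ih (j / 2) (by rw [pow_succ] at hj; omega), Nat.forall_lt_succ_right]
    refine and_congr (forall₂_congr fun i hi => ?_) (by simp)
    rw [Nat.div_div_eq_div_mul, ← pow_succ', show n - 1 - i + 1 = n + 1 - 1 - i by omega]

lemma binWeight_eq_prod (p : ℕ → ℕ → ℝ) (n j : ℕ) :
    binWeight p n j = ∏ i ∈ Finset.range n, p i (j / 2 ^ (n - 1 - i) % 2) := by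
  induction n generalizing j with
  | zero => simp [binWeight]
  | succ n ih =>
    rw [binWeight, ih, Finset.prod_range_succ]
    congr 1
    · refine Finset.prod_congr rfl fun i hi => ?_
      have := Finset.mem_range.mp hi
      rw [Nat.div_div_eq_div_mul, ← pow_succ', show n - 1 - i + 1 = n + 1 - 1 - i by omega]
    · simp

lemma measure_binPrefix_eq {T : ℕ → ℕ} {a b : ℕ → ℝ} {m : Measure (Omg 2 2 T)}
    (hm : ∀ (n : ℕ) (w : Word 2 2 T n),
      m (cyl 2 2 T n w) = ENNReal.ofReal (cylWeight 2 2 T a b n w))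
    (n j : ℕ) (hj : j < 2 ^ n) :
    m {x | binPrefix x n = j} = ENNReal.ofReal (binWeight (digitWeight T a b) n j) := by
  let w : Word 2 2 T n := fun i =>
    ⟨j / 2 ^ (n - 1 - i.val) % 2, (Nat.mod_lt _ two_pos).trans_eq (Yc_two T i.val).symm⟩
  have hset : {x : Omg 2 2 T | binPrefix x n = j} = cyl 2 2 T n w := by
    ext x
    simp only [mem_ofPred_eq, cyl, binPrefix_eq_iff x n j hj, Fin.ext_iff, w, Fin.forall_iff]
  rw [hset, hm, binWeight_eq_prod, Finset.prod_range]
  rfl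

/-- A family of two-point probability vectors with all weights in `[δ, ρ]`. -/
structure IsBinaryWeight (p : ℕ → ℕ → ℝ) (δ ρ : ℝ) : Prop where
  pos : 0 < δ
  lt_one : ρ < 1
  lower : ∀ n e, e < 2 → δ ≤ p n e
  upper : ∀ n e, e < 2 → p n e ≤ ρ
  sum_eq : ∀ n, p n 0 + p n 1 = 1

lemma exists_isBinaryWeight (T : ℕ → ℕ) {a b : ℕ → ℝ} (ha : ∀ i, i < 2 → 0 < a i)
    (hb : ∀ j, j < 2 → 0 < b j) (hsa : ∑ i ∈ Finset.range 2, a i = 1)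
    (hsb : ∑ j ∈ Finset.range 2, b j = 1) :
    ∃ δ ρ, IsBinaryWeight (digitWeight T a b) δ ρ := by
  simp only [Finset.sum_range_succ, Finset.sum_range_zero, zero_add] at hsa hsb
  have a0 := ha 0 (by norm_num)
  have a1 := ha 1 (by norm_num)
  have b0 := hb 0 (by norm_num)
  have b1 := hb 1 (by norm_num)
  have key : ∃ δ > 0, δ ≤ a 0 ∧ δ ≤ a 1 ∧ δ ≤ b 0 ∧ δ ≤ b 1 :=
    ⟨min (min (a 0) (a 1)) (min (b 0) (b 1)), by positivity, by simp, by simp, by simp, by simp⟩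
  obtain ⟨δ, hδ, h1, h2, h3, h4⟩ := key
  refine ⟨δ, 1 - δ, hδ, by linarith, fun n e he => ?_, fun n e he => ?_, fun n => ?_⟩
  · unfold digitWeight
    interval_cases e <;> split_ifs <;> assumption
  · unfold digitWeight
    interval_cases e <;> split_ifs <;> linarith
  · unfold digitWeight
    split_ifs <;> assumption

lemma sum_range_two_pow_succ (f : ℕ → ℝ) (n : ℕ) :
    ∑ j ∈ Finset.range (2 ^ (n + 1)), f j =
      ∑ j ∈ Finset.range (2 ^ n), (f (2 * j) + f (2 * j + 1)) := by
  rw [pow_succ']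
  induction 2 ^ n with
  | zero => simp
  | succ m ih =>
    rw [Finset.sum_range_succ, ← ih, mul_add, mul_one, Finset.sum_range_succ,
      Finset.sum_range_succ, add_assoc]

namespace IsBinaryWeight

variable {p : ℕ → ℕ → ℝ} {δ ρ : ℝ}

lemma nonneg (hp : IsBinaryWeight p δ ρ) (n j : ℕ) : 0 ≤ p n (j % 2) :=
  hp.pos.le.trans (hp.lower _ _ (Nat.mod_lt _ two_pos))

lemma rho_pos (hp : IsBinaryWeight p δ ρ) : 0 < ρ :=
  hp.pos.trans_le ((hp.lower 0 0 two_pos).trans (hp.upper 0 0 two_pos))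

lemma binWeight_nonneg (hp : IsBinaryWeight p δ ρ) (n j : ℕ) : 0 ≤ binWeight p n j := by
  induction n generalizing j with
  | zero => simp [binWeight]
  | succ n ih => exact mul_nonneg (ih _) (hp.nonneg n j)

lemma sum_binWeight (hp : IsBinaryWeight p δ ρ) (n : ℕ) :
    ∑ j ∈ Finset.range (2 ^ n), binWeight p n j = 1 := by
  induction n with
  | zero => simp [binWeight]
  | succ n ih =>
    rw [sum_range_two_pow_succ, ← ih]
    refine Finset.sum_congr rfl fun j _ => ?_
    rw [binWeight, binWeight, show 2 * j / 2 = j by omega, show (2 * j + 1) / 2 = j by omega,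
      show 2 * j % 2 = 0 by omega, show (2 * j + 1) % 2 = 1 by omega, ← mul_add, hp.sum_eq, mul_one]

/-- The integers with `k` prescribed last binary digits carry a weight at most `ρ ^ k`. -/
lemma sum_binWeight_mod_le (hp : IsBinaryWeight p δ ρ) (n k r : ℕ) (hk : k ≤ n) :
    (∑ j ∈ Finset.range (2 ^ n), if j % 2 ^ k = r then binWeight p n j else 0) ≤ ρ ^ k := by
  induction k generalizing n r with
  | zero =>
    rw [pow_zero ρ, ← hp.sum_binWeight n]
    refine Finset.sum_le_sum fun j _ => ?_
    split_ifs
    · exact le_rfl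
    · exact hp.binWeight_nonneg n j
  | succ k ih =>
    obtain ⟨n, rfl⟩ : ∃ n', n = n' + 1 := ⟨n - 1, by omega⟩
    rw [sum_range_two_pow_succ, pow_succ' ρ]
    refine le_trans ?_ (mul_le_mul_of_nonneg_left (ih n (r / 2) (by omega)) hp.rho_pos.le)
    rw [Finset.mul_sum]
    refine Finset.sum_le_sum fun j _ => ?_
    have e1 : 2 * j % 2 ^ (k + 1) = 2 * (j % 2 ^ k) := by
      rw [pow_succ', Nat.mul_mod_mul_left]
    have e2 : (2 * j + 1) % 2 ^ (k + 1) = 2 * (j % 2 ^ k) + 1 := by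
      rw [pow_succ', Nat.mod_mul, show (2 * j + 1) / 2 = j by omega]
      omega
    rw [e1, e2, binWeight, binWeight, show 2 * j / 2 = j by omega,
      show (2 * j + 1) / 2 = j by omega, show 2 * j % 2 = 0 by omega,
      show (2 * j + 1) % 2 = 1 by omega]
    have hw := hp.binWeight_nonneg n j
    have u0 := mul_le_mul_of_nonneg_left (hp.upper n 0 (by norm_num)) hw
    have u1 := mul_le_mul_of_nonneg_left (hp.upper n 1 (by norm_num)) hw
    split_ifs <;> first | omega | linarith

/-- Integers which agree up to their last `k` binary digits have comparable weights. -/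
lemma binWeight_le (hp : IsBinaryWeight p δ ρ) {n k i j : ℕ} (hk : k ≤ n)
    (h : i / 2 ^ k = j / 2 ^ k) : binWeight p n i ≤ (1 / δ) ^ k * binWeight p n j := by
  induction k generalizing n i j with
  | zero => simp at h; simp [h]
  | succ k ih =>
    obtain ⟨n, rfl⟩ : ∃ n', n = n' + 1 := ⟨n - 1, by omega⟩
    have hδ := hp.pos
    have h1 : binWeight p n (i / 2) ≤ (1 / δ) ^ k * binWeight p n (j / 2) := by
      refine ih (by omega) ?_
      rwa [Nat.div_div_eq_div_mul, Nat.div_div_eq_div_mul, ← pow_succ']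
    have h2 : p n (i % 2) ≤ 1 / δ * p n (j % 2) := by
      have hi := hp.upper n (i % 2) (Nat.mod_lt _ two_pos)
      have hj := hp.lower n (j % 2) (Nat.mod_lt _ two_pos)
      calc p n (i % 2) ≤ 1 := hi.trans hp.lt_one.le
        _ = 1 / δ * δ := by field_simp
        _ ≤ _ := by gcongr
    have h3 := hp.nonneg n i
    have h4 := hp.binWeight_nonneg n (j / 2)
    calc binWeight p n (i / 2) * p n (i % 2)
        ≤ ((1 / δ) ^ k * binWeight p n (j / 2)) * (1 / δ * p n (j % 2)) := by gcongr
      _ = _ := by rw [binWeight]; ring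

end IsBinaryWeight

lemma summable_pow_sqrt {ρ : ℝ} (h0 : 0 < ρ) (h1 : ρ < 1) :
    Summable fun n : ℕ => ρ ^ n.sqrt := by
  have hlim : Tendsto (fun n : ℕ => (n : ℝ) ^ 4 * ρ ^ n) atTop (𝓝 0) :=
    tendsto_pow_const_mul_const_pow_of_lt_one 4 h0.le h1
  obtain ⟨C, hC⟩ := (hlim.comp (tendsto_add_atTop_nat 1)).bddAbove_range
  refine Summable.of_nonneg_of_le (fun n => by positivity) (fun n => ?_)
    ((((summable_nat_add_iff 1).mpr
      (Real.summable_one_div_nat_pow.mpr one_lt_two))).mul_left (C / ρ))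
  have hn : ((n + 1 : ℕ) : ℝ) ≤ ((n.sqrt + 1 : ℕ) : ℝ) ^ 2 := by
    exact_mod_cast Nat.succ_le_succ_sqrt' n
  have hb : ((n.sqrt + 1 : ℕ) : ℝ) ^ 4 * ρ ^ (n.sqrt + 1) ≤ C := hC ⟨n.sqrt, rfl⟩
  have hn' : (0 : ℝ) < ((n + 1 : ℕ) : ℝ) := by positivity
  rw [div_mul_div_comm, mul_one, le_div_iff₀ (by positivity)]
  calc ρ ^ n.sqrt * (ρ * ((n + 1 : ℕ) : ℝ) ^ 2)
      ≤ ρ ^ n.sqrt * (ρ * (((n.sqrt + 1 : ℕ) : ℝ) ^ 2) ^ 2) := by gcongr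
    _ = ((n.sqrt + 1 : ℕ) : ℝ) ^ 4 * ρ ^ (n.sqrt + 1) := by ring
    _ ≤ C := hb

section Measure

variable {T : ℕ → ℕ} {a b : ℕ → ℝ} {δ ρ : ℝ} {m : Measure (Omg 2 2 T)}

lemma measure_binPrefix_mod_le
    (hm : ∀ (n : ℕ) (w : Word 2 2 T n),
      m (cyl 2 2 T n w) = ENNReal.ofReal (cylWeight 2 2 T a b n w))
    (hp : IsBinaryWeight (digitWeight T a b) δ ρ) (n k r : ℕ) (hk : k ≤ n) :
    m {x | binPrefix x n % 2 ^ k = r} ≤ ENNReal.ofReal (ρ ^ k) := by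
  have hsub : {x : Omg 2 2 T | binPrefix x n % 2 ^ k = r} ⊆
      ⋃ j ∈ (Finset.range (2 ^ n)).filter fun j => j % 2 ^ k = r, {x | binPrefix x n = j} := by
    intro x hx
    simp only [mem_iUnion, Finset.mem_filter, Finset.mem_range]
    exact ⟨_, ⟨binPrefix_lt x n, hx⟩, rfl⟩
  refine (measure_mono hsub).trans ((measure_biUnion_finset_le _ _).trans ?_)
  refine le_trans ?_ (ENNReal.ofReal_le_ofReal (hp.sum_binWeight_mod_le n k r hk))
  rw [← Finset.sum_filter, ENNReal.ofReal_sum_of_nonneg fun j _ => hp.binWeight_nonneg n j]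
  refine Finset.sum_le_sum fun j hj => ?_
  rw [measure_binPrefix_eq hm n j (Finset.mem_range.mp (Finset.mem_filter.mp hj).1)]

lemma ae_eventuallyMixed
    (hm : ∀ (n : ℕ) (w : Word 2 2 T n),
      m (cyl 2 2 T n w) = ENNReal.ofReal (cylWeight 2 2 T a b n w))
    (hp : IsBinaryWeight (digitWeight T a b) δ ρ) : ∀ᵐ x ∂m, EventuallyMixed x := by
  have hsum (r : ℕ → ℕ) :
      ∑' n : ℕ, m {x | binPrefix x n % 2 ^ n.sqrt = r n} ≠ ∞ := by
    refine ne_top_of_le_ne_top ?_ (ENNReal.tsum_le_tsum fun n =>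
      measure_binPrefix_mod_le hm hp n n.sqrt (r n) n.sqrt_le_self)
    exact (summable_pow_sqrt hp.rho_pos hp.lt_one).tsum_ofReal_ne_top
  filter_upwards [ae_eventually_notMem (hsum fun _ => 0),
    ae_eventually_notMem (hsum fun n => 2 ^ n.sqrt - 1)] with x h1 h2
  filter_upwards [h1, h2] with n h1 h2
  refine ⟨fun h => h1 (Nat.mod_eq_zero_of_dvd h), fun h => h2 ?_⟩
  obtain ⟨c, hc⟩ := h
  obtain ⟨c, rfl⟩ : ∃ c', c = c' + 1 := Nat.exists_eq_succ_of_ne_zero (by rintro rfl; simp at hc)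
  have hpos : 0 < 2 ^ n.sqrt := by positivity
  have : binPrefix x n = 2 ^ n.sqrt - 1 + 2 ^ n.sqrt * c := by
    rw [mul_add] at hc; omega
  rw [this, Nat.add_mul_mod_self_left, Nat.mod_eq_of_lt (by omega)]

lemma map_gammaMap_Icc
    (hm : ∀ (n : ℕ) (w : Word 2 2 T n),
      m (cyl 2 2 T n w) = ENNReal.ofReal (cylWeight 2 2 T a b n w))
    (hp : IsBinaryWeight (digitWeight T a b) δ ρ) (n j : ℕ) (hj : j < 2 ^ n) :
    m.map (gammaMap 2 2 T) (Icc ((j : ℝ) / 2 ^ n) (((j : ℝ) + 1) / 2 ^ n)) =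
      ENNReal.ofReal (binWeight (digitWeight T a b) n j) := by
  rw [Measure.map_apply (measurable_gammaMap T) measurableSet_Icc, ← measure_binPrefix_eq hm n j hj]
  refine measure_congr ?_
  filter_upwards [ae_eventuallyMixed hm hp] with x hx
  exact propext (hx.mem_Icc_iff n j)

lemma map_gammaMap_Icc_le
    (hm : ∀ (n : ℕ) (w : Word 2 2 T n),
      m (cyl 2 2 T n w) = ENNReal.ofReal (cylWeight 2 2 T a b n w))
    (hp : IsBinaryWeight (digitWeight T a b) δ ρ) {n i j : ℕ} (hi : i < 2 ^ n) (hj : j < 2 ^ n)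
    (h : i / 2 ^ n.sqrt = j / 2 ^ n.sqrt) :
    m.map (gammaMap 2 2 T) (Icc ((i : ℝ) / 2 ^ n) (((i : ℝ) + 1) / 2 ^ n)) ≤
      ENNReal.ofReal ((1 / δ) ^ (Real.sqrt n + 1)) *
        m.map (gammaMap 2 2 T) (Icc ((j : ℝ) / 2 ^ n) (((j : ℝ) + 1) / 2 ^ n)) := by
  have hδ := hp.pos
  have hδ1 : 1 ≤ 1 / δ := by
    rw [one_le_div hδ]
    exact (hp.lower 0 0 two_pos).trans ((hp.upper 0 0 two_pos).trans hp.lt_one.le)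
  rw [map_gammaMap_Icc hm hp n i hi, map_gammaMap_Icc hm hp n j hj,
    ← ENNReal.ofReal_mul (by positivity)]
  refine ENNReal.ofReal_le_ofReal ((hp.binWeight_le n.sqrt_le_self h).trans ?_)
  refine mul_le_mul_of_nonneg_right ?_ (hp.binWeight_nonneg n j)
  rw [← Real.rpow_natCast]
  refine Real.rpow_le_rpow_of_exponent_le hδ1 ?_
  linarith [Real.nat_sqrt_le_real_sqrt (a := n)]

end Measure

lemma taW_pos {p : ℕ → ℝ} (hp : ∀ i, i < 2 → 0 < p i) (q : ℝ) (i : ℕ) (hi : i < 2) :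
    0 < taW 2 p q i :=
  div_pos (Real.rpow_pos_of_pos (hp i hi) q)
    (Finset.sum_pos (fun j hj => Real.rpow_pos_of_pos (hp j (Finset.mem_range.mp hj)) q) (by simp))

lemma sum_taW {p : ℕ → ℝ} (hp : ∀ i, i < 2 → 0 < p i) (q : ℝ) :
    ∑ i ∈ Finset.range 2, taW 2 p q i = 1 := by
  simp only [taW]
  rw [← Finset.sum_div]
  exact div_self (Finset.sum_pos
    (fun j hj => Real.rpow_pos_of_pos (hp j (Finset.mem_range.mp hj)) q) (by simp)).ne'

lemma measurable_dyadIdx (n : ℕ) : Measurable (dyadIdx n) :=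
  (Int.measurable_ceil.comp (measurable_id.mul_const _)).sub_const 1

lemma add_one_div_of_not_dvd {s d : ℕ} (h : ¬ d ∣ s + 1) : (s + 1) / d = s / d := by
  rw [Nat.succ_div, if_neg h, add_zero]

lemma measurableSet_eventually_atTop {α : Type*} [MeasurableSpace α] {p : ℕ → α → Prop}
    (hp : ∀ n, MeasurableSet {x | p n x}) : MeasurableSet {x | ∀ᶠ n in atTop, p n x} := by
  have h : {x | ∀ᶠ n in atTop, p n x} = ⋃ N, ⋂ n, ⋂ (_ : N ≤ n), {x | p n x} := by
    ext x
    simp [eventually_atTop]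
  rw [h]
  exact MeasurableSet.iUnion fun N => MeasurableSet.iInter fun n => MeasurableSet.iInter fun _ => hp n

/-- weak doubling along the auxiliary measures `ν_q`, `c₁ = c₂ = 2`. -/
theorem stmt4 (T : ℕ → ℕ) (hT1 : T 1 = 1) (hTmono : ∀ k, 1 ≤ k → T k < T (k + 1))
    (hTrat : Tendsto (fun k => (T (k + 1) : ℝ) / (T k : ℝ)) atTop atTop)
    (a b : ℕ → ℝ) (ha : ∀ i, i < 2 → 0 < a i ∧ a i < 1)
    (hb : ∀ j, j < 2 → 0 < b j ∧ b j < 1)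
    (hsa : ∑ i ∈ Finset.range 2, a i = 1) (hsb : ∑ j ∈ Finset.range 2, b j = 1)
    (q : ℝ)
    (μ μq : Measure (Omg 2 2 T)) [IsProbabilityMeasure μ] [IsProbabilityMeasure μq]
    (hμ : ∀ (n : ℕ) (w : Word 2 2 T n),
      μ (cyl 2 2 T n w) = ENNReal.ofReal (cylWeight 2 2 T a b n w))
    (hμq : ∀ (n : ℕ) (w : Word 2 2 T n),
      μq (cyl 2 2 T n w) = ENNReal.ofReal (cylWeight 2 2 T (taW 2 a q) (taW 2 b q) n w)) :
    ∃ C₀ : ℝ, 1 < C₀ ∧ ∀ᵐ x ∂(μq.map (gammaMap 2 2 T)), ∀ᶠ n : ℕ in atTop,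
      (μ.map (gammaMap 2 2 T) (Idyad n x) ≤
          ENNReal.ofReal (C₀ ^ (Real.sqrt n + 1)) * μ.map (gammaMap 2 2 T) (IdyadP n x) ∧
        μ.map (gammaMap 2 2 T) (IdyadP n x) ≤
          ENNReal.ofReal (C₀ ^ (Real.sqrt n + 1)) * μ.map (gammaMap 2 2 T) (Idyad n x)) ∧
      (μ.map (gammaMap 2 2 T) (Idyad n x) ≤
          ENNReal.ofReal (C₀ ^ (Real.sqrt n + 1)) * μ.map (gammaMap 2 2 T) (IdyadM n x) ∧
        μ.map (gammaMap 2 2 T) (IdyadM n x) ≤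
          ENNReal.ofReal (C₀ ^ (Real.sqrt n + 1)) * μ.map (gammaMap 2 2 T) (Idyad n x)) := by
  have ha' : ∀ i, i < 2 → 0 < a i := fun i hi => (ha i hi).1
  have hb' : ∀ i, i < 2 → 0 < b i := fun i hi => (hb i hi).1
  obtain ⟨δ, ρ, hp⟩ := exists_isBinaryWeight T ha' hb' hsa hsb
  obtain ⟨δq, ρq, hpq⟩ := exists_isBinaryWeight T (taW_pos ha' q) (taW_pos hb' q)
    (sum_taW ha' q) (sum_taW hb' q)
  have hδ1 : δ < 1 := (hp.lower 0 0 two_pos).trans_lt ((hp.upper 0 0 two_pos).trans_lt hp.lt_one)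
  refine ⟨1 / δ, (one_lt_div hp.pos).mpr hδ1, ?_⟩
  rw [ae_map_iff (measurable_gammaMap T).aemeasurable]
  swap
  · refine measurableSet_eventually_atTop fun n => ?_
    let P : ℤ → Set ℝ := fun i => Icc ((i : ℝ) / 2 ^ n) (((i : ℝ) + 1) / 2 ^ n)
    let Pr : ℤ → Set ℝ := fun i => Icc (((i : ℝ) + 1) / 2 ^ n) (((i : ℝ) + 2) / 2 ^ n)
    let Pl : ℤ → Set ℝ := fun i => Icc (((i : ℝ) - 1) / 2 ^ n) ((i : ℝ) / 2 ^ n)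
    let ν := μ.map (gammaMap 2 2 T)
    let C := ENNReal.ofReal ((1 / δ) ^ (Real.sqrt n + 1))
    exact measurable_dyadIdx n (MeasurableSet.of_discrete
      (s := {i : ℤ | (ν (P i) ≤ C * ν (Pr i) ∧ ν (Pr i) ≤ C * ν (P i)) ∧
        (ν (P i) ≤ C * ν (Pl i) ∧ ν (Pl i) ≤ C * ν (P i))}))
  filter_upwards [ae_eventuallyMixed hμq hpq] with x hx
  filter_upwards [hx] with n hn
  obtain ⟨s, hs⟩ : ∃ s, binPrefix x n = s := ⟨_, rfl⟩
  have hs2 : s < 2 ^ n := hs ▸ binPrefix_lt x n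
  rw [hs] at hn
  have hd : 2 ^ n.sqrt ∣ 2 ^ n := pow_dvd_pow 2 n.sqrt_le_self
  have hr : s + 1 < 2 ^ n := by
    refine lt_of_le_of_ne hs2 fun h => hn.2 ?_
    rwa [h]
  obtain ⟨t, rfl⟩ : ∃ t, s = t + 1 := Nat.exists_eq_succ_of_ne_zero (by rintro rfl; simp at hn)
  have hI : Idyad n (gammaMap 2 2 T x) =
      Icc (((t + 1 : ℕ) : ℝ) / 2 ^ n) ((((t + 1 : ℕ) : ℝ) + 1) / 2 ^ n) := by
    rw [Idyad, hx.dyadIdx_eq, hs]; push_cast; rfl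
  have hIP : IdyadP n (gammaMap 2 2 T x) =
      Icc (((t + 1 + 1 : ℕ) : ℝ) / 2 ^ n) ((((t + 1 + 1 : ℕ) : ℝ) + 1) / 2 ^ n) := by
    rw [IdyadP, hx.dyadIdx_eq, hs]; push_cast; ring_nf
  have hIM : IdyadM n (gammaMap 2 2 T x) =
      Icc ((t : ℝ) / 2 ^ n) (((t : ℝ) + 1) / 2 ^ n) := by
    rw [IdyadM, hx.dyadIdx_eq, hs]; push_cast; ring_nf
  have hdivP := add_one_div_of_not_dvd hn.2
  have hdivM := add_one_div_of_not_dvd hn.1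
  rw [hI, hIP, hIM]
  have ht : t < 2 ^ n := by omega
  exact ⟨⟨map_gammaMap_Icc_le hμ hp hs2 hr hdivP.symm, map_gammaMap_Icc_le hμ hp hr hs2 hdivP⟩,
    map_gammaMap_Icc_le hμ hp hs2 ht hdivM, map_gammaMap_Icc_le hμ hp ht hs2 hdivM.symm⟩

end MF
end
end

section
/- For every $q\in\mathbb{R}$, the projected measure $\nu=\gamma_\ast(\mu)$ on $[0,1]$ (whose support is $[0,1]$) satisfies $b_\nu(q)=b_\mu(q)=\min\{\theta_a(q),\theta_b(q)\}$, where $b$ is Olsen's multifractal Hausdorff dimension function. -/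
open MeasureTheory Metric Set Filter Topology Classical
open scoped ENNReal NNReal

noncomputable section

namespace MF

/-! ### Olsen's multifractal measures and dimension functions on a metric space -/

variable {X : Type} [MetricSpace X]

/-! ### Mixed symbolic spaces with an arbitrary sequence of alphabets -/

/-- The product `∏ₙ {0, …, c n - 1}`. -/
abbrev SeqSpace (c : ℕ → ℕ) : Type := ∀ n : ℕ, Fin (c n)

/-- The cylinder of generation `n` around `x`. -/
def cylAt (c : ℕ → ℕ) (x : SeqSpace c) (n : ℕ) : Set (SeqSpace c) :=
  {y | ∀ i, i < n → y i = x i}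

/-- The diameter of the cylinders of generation `n`. -/
def scale (c : ℕ → ℕ) (n : ℕ) : ℝ := ∏ j ∈ Finset.range n, (c j : ℝ)⁻¹

/-- The rank of the cylinder of generation `n` around `x` in the lexicographic order. -/
def rank (c : ℕ → ℕ) (x : SeqSpace c) : ℕ → ℕ
  | 0 => 0
  | n + 1 => rank c x n * c n + (x n).val

/-- The natural projection of the symbolic space onto the unit interval. -/
def proj (c : ℕ → ℕ) (x : SeqSpace c) : ℝ := ∑' n : ℕ, ((x n).val : ℝ) * scale c (n + 1)

/-- Between the positions `n` and `N`, the digits of `x` are neither all minimal nor all maximal. -/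
def MixedRun (c : ℕ → ℕ) (x : SeqSpace c) (n N : ℕ) : Prop :=
  (∃ j, n ≤ j ∧ j < N ∧ (x j).val ≠ 0) ∧ ∃ j, n ≤ j ∧ j < N ∧ (x j).val + 1 ≠ c j

lemma self_mem_cylAt (c : ℕ → ℕ) (x : SeqSpace c) (n : ℕ) : x ∈ cylAt c x n := fun _ _ => rfl

lemma cylAt_anti (c : ℕ → ℕ) (x : SeqSpace c) {m n : ℕ} (h : m ≤ n) :
    cylAt c x n ⊆ cylAt c x m := fun _ hy i hi => hy i (hi.trans_le h)

lemma scale_zero (c : ℕ → ℕ) : scale c 0 = 1 := by simp [scale]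

lemma scale_succ (c : ℕ → ℕ) (n : ℕ) : scale c (n + 1) = scale c n * (c n : ℝ)⁻¹ := by
  simp only [scale, Finset.prod_range_succ]

section Scale

variable {c : ℕ → ℕ} (hc : ∀ n, 2 ≤ c n)

include hc

lemma card_pos_real (n : ℕ) : (0 : ℝ) < c n := by
  have := hc n
  exact_mod_cast (by omega : 0 < c n)

lemma scale_pos (n : ℕ) : 0 < scale c n :=
  Finset.prod_pos fun j _ => inv_pos.2 (card_pos_real hc j)

lemma card_mul_scale_succ (n : ℕ) : (c n : ℝ) * scale c (n + 1) = scale c n := by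
  rw [scale_succ]
  have := card_pos_real hc n
  field_simp

lemma two_mul_scale_succ_le (n : ℕ) : 2 * scale c (n + 1) ≤ scale c n := by
  rw [← card_mul_scale_succ hc n]
  have : (2 : ℝ) ≤ c n := by exact_mod_cast hc n
  exact mul_le_mul_of_nonneg_right this (scale_pos hc _).le

lemma scale_strictAnti : StrictAnti (scale c) :=
  strictAnti_nat_of_succ_lt fun n => by
    linarith [two_mul_scale_succ_le hc n, scale_pos hc (n + 1)]

lemma scale_le_geometric (n : ℕ) : scale c n ≤ (1 / 2 : ℝ) ^ n := by
  induction n with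
  | zero => simp [scale_zero]
  | succ n ih => rw [pow_succ]; linarith [two_mul_scale_succ_le hc n]

lemma scale_tendsto : Tendsto (scale c) atTop (𝓝 0) :=
  squeeze_zero (fun n => (scale_pos hc n).le) (scale_le_geometric hc)
    (tendsto_pow_atTop_nhds_zero_of_lt_one (by norm_num) (by norm_num))

lemma scale_summable : Summable (scale c) :=
  Summable.of_nonneg_of_le (fun n => (scale_pos hc n).le) (scale_le_geometric hc)
    (summable_geometric_of_lt_one (by norm_num) (by norm_num))

lemma exists_scale_le_lt {r : ℝ} (hr : 0 < r) {n₀ : ℕ} (hr' : r < scale c n₀) :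
    ∃ n, n₀ ≤ n ∧ scale c (n + 1) ≤ r ∧ r < scale c n := by
  have hex : ∃ k, scale c (n₀ + k) ≤ r := by
    obtain ⟨N, hN⟩ := ((scale_tendsto hc).eventually (gt_mem_nhds hr)).exists
    exact ⟨N, ((scale_strictAnti hc).antitone (Nat.le_add_left N n₀)).trans hN.le⟩
  have h0 : Nat.find hex ≠ 0 := by
    intro h
    have := Nat.find_spec hex
    rw [h] at this
    simp only [add_zero] at this
    linarith
  obtain ⟨k, hk⟩ := Nat.exists_eq_succ_of_ne_zero h0
  refine ⟨n₀ + k, Nat.le_add_right _ _, ?_, ?_⟩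
  · have := Nat.find_spec hex
    rw [hk] at this
    exact this
  · exact not_le.1 (Nat.find_min hex (by omega))

lemma digit_mul_scale_le (x : SeqSpace c) (n : ℕ) :
    ((x n).val : ℝ) * scale c (n + 1) ≤ scale c n - scale c (n + 1) := by
  have h : ((x n).val : ℝ) + 1 ≤ c n := by exact_mod_cast (x n).isLt
  nlinarith [card_mul_scale_succ hc n, scale_pos hc (n + 1)]

lemma digit_mul_scale_nonneg (x : SeqSpace c) (n : ℕ) :
    0 ≤ ((x n).val : ℝ) * scale c (n + 1) :=
  mul_nonneg (Nat.cast_nonneg _) (scale_pos hc _).le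

lemma digit_summable (x : SeqSpace c) :
    Summable fun n => ((x n).val : ℝ) * scale c (n + 1) :=
  Summable.of_nonneg_of_le (digit_mul_scale_nonneg hc x)
    (fun n => (digit_mul_scale_le hc x n).trans (by linarith [scale_pos hc (n + 1)]))
    (scale_summable hc)

lemma rank_mul_scale (x : SeqSpace c) (n : ℕ) :
    (rank c x n : ℝ) * scale c n =
      ∑ j ∈ Finset.range n, ((x j).val : ℝ) * scale c (j + 1) := by
  induction n with
  | zero => simp [rank]
  | succ n ih =>
    rw [Finset.sum_range_succ, ← ih, rank, ← card_mul_scale_succ hc n]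
    push_cast
    ring

lemma tendsto_rank_mul_scale (x : SeqSpace c) :
    Tendsto (fun n => (rank c x n : ℝ) * scale c n) atTop (𝓝 (proj c x)) := by
  simp_rw [rank_mul_scale hc]
  exact (digit_summable hc x).hasSum.tendsto_sum_nat

lemma rank_mul_scale_monotone (x : SeqSpace c) :
    Monotone fun n => (rank c x n : ℝ) * scale c n :=
  monotone_nat_of_le_succ fun n => by
    simp only [rank_mul_scale hc, Finset.sum_range_succ]
    linarith [digit_mul_scale_nonneg hc x n]

lemma rank_add_one_mul_scale_antitone (x : SeqSpace c) :
    Antitone fun n => ((rank c x n : ℝ) + 1) * scale c n :=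
  antitone_nat_of_succ_le fun n => by
    simp only [add_mul, one_mul, rank_mul_scale hc, Finset.sum_range_succ]
    linarith [digit_mul_scale_le hc x n]

lemma rank_mul_scale_le_proj (x : SeqSpace c) (n : ℕ) :
    (rank c x n : ℝ) * scale c n ≤ proj c x :=
  (rank_mul_scale_monotone hc x).ge_of_tendsto (tendsto_rank_mul_scale hc x) n

lemma proj_le_rank_add_one (x : SeqSpace c) (n : ℕ) :
    proj c x ≤ ((rank c x n : ℝ) + 1) * scale c n := by
  refine (rank_add_one_mul_scale_antitone hc x).le_of_tendsto ?_ n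
  simpa [add_mul] using (tendsto_rank_mul_scale hc x).add (scale_tendsto hc)

omit hc in
lemma mem_cylAt_of_rank_eq (x y : SeqSpace c) (n : ℕ) (h : rank c y n = rank c x n) :
    y ∈ cylAt c x n := by
  induction n with
  | zero => intro i hi; omega
  | succ n ih =>
    simp only [rank] at h
    have hx := (x n).isLt
    have hy := (y n).isLt
    have h1 : (y n).val = (x n).val := by
      have := congrArg (· % c n) h
      simpa [Nat.add_mod, Nat.mod_eq_of_lt hx, Nat.mod_eq_of_lt hy] using this
    have h2 : rank c y n = rank c x n := by
      have h3 : rank c y n * c n = rank c x n * c n := by omega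
      exact Nat.eq_of_mul_eq_mul_right (by omega) h3
    intro i hi
    rcases Nat.lt_succ_iff_lt_or_eq.1 hi with hi | rfl
    · exact ih h2 i hi
    · exact Fin.ext h1

omit hc in
lemma rank_eq_of_mem_cylAt (x y : SeqSpace c) (n : ℕ) (h : y ∈ cylAt c x n) :
    rank c y n = rank c x n := by
  induction n with
  | zero => rfl
  | succ n ih =>
    rw [rank, rank, ih (cylAt_anti c x n.le_succ h), h n n.lt_succ_self]

lemma dist_proj_le (x y : SeqSpace c) (n : ℕ) (h : y ∈ cylAt c x n) :
    dist (proj c y) (proj c x) ≤ scale c n := by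
  have hk := rank_eq_of_mem_cylAt x y n h
  have h1 := rank_mul_scale_le_proj hc x n
  have h2 := proj_le_rank_add_one hc x n
  have h3 := rank_mul_scale_le_proj hc y n
  have h4 := proj_le_rank_add_one hc y n
  rw [hk] at h3 h4
  rw [Real.dist_eq, abs_le]
  constructor <;> linarith

lemma rank_near_of_dist_proj_le (x y : SeqSpace c) (n : ℕ)
    (h : dist (proj c y) (proj c x) ≤ scale c n) :
    rank c y n ≤ rank c x n + 2 ∧ rank c x n ≤ rank c y n + 2 := by
  have h1 := rank_mul_scale_le_proj hc x n
  have h2 := proj_le_rank_add_one hc x n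
  have h3 := rank_mul_scale_le_proj hc y n
  have h4 := proj_le_rank_add_one hc y n
  rw [Real.dist_eq, abs_le] at h
  have hs := scale_pos hc n
  constructor
  · have : (rank c y n : ℝ) ≤ rank c x n + 2 :=
      le_of_mul_le_mul_right (by linarith) hs
    exact_mod_cast this
  · have : (rank c x n : ℝ) ≤ rank c y n + 2 :=
      le_of_mul_le_mul_right (by linarith) hs
    exact_mod_cast this

lemma rank_gap_left (x : SeqSpace c) {n N j : ℕ} (hnj : n ≤ j) (hjN : j < N)
    (hj : (x j).val ≠ 0) :
    (rank c x n : ℝ) * scale c n + scale c N ≤ rank c x N * scale c N := by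
  have h1 := rank_mul_scale_monotone hc x hnj
  have h2 := rank_mul_scale_monotone hc x (Nat.succ_le_of_lt hjN)
  simp only [Nat.succ_eq_add_one] at h1 h2
  rw [rank_mul_scale hc x (j + 1), Finset.sum_range_succ, ← rank_mul_scale hc] at h2
  have h3 : (1 : ℝ) ≤ (x j).val := by exact_mod_cast Nat.one_le_iff_ne_zero.2 hj
  have h4 := (scale_strictAnti hc).antitone (Nat.succ_le_of_lt hjN)
  simp only [Nat.succ_eq_add_one] at h4
  nlinarith [scale_pos hc (j + 1)]

lemma rank_gap_right (x : SeqSpace c) {n N j : ℕ} (hnj : n ≤ j) (hjN : j < N)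
    (hj : (x j).val + 1 ≠ c j) :
    ((rank c x N : ℝ) + 1) * scale c N + scale c N ≤ (rank c x n + 1) * scale c n := by
  have h1 := rank_add_one_mul_scale_antitone hc x hnj
  have h2 := rank_add_one_mul_scale_antitone hc x (Nat.succ_le_of_lt hjN)
  simp only [Nat.succ_eq_add_one] at h1 h2
  rw [add_mul (rank c x (j + 1) : ℝ), rank_mul_scale hc x (j + 1), Finset.sum_range_succ,
    ← rank_mul_scale hc] at h2
  have h3 : ((x j).val : ℝ) + 2 ≤ c j := by
    have := (x j).isLt
    exact_mod_cast (by omega : (x j).val + 2 ≤ c j)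
  have h4 := (scale_strictAnti hc).antitone (Nat.succ_le_of_lt hjN)
  simp only [Nat.succ_eq_add_one] at h4
  nlinarith [scale_pos hc (j + 1), card_mul_scale_succ hc j]

lemma mem_cylAt_of_dist_proj_lt (x y : SeqSpace c) {n N : ℕ} (hx : MixedRun c x n N)
    (h : dist (proj c y) (proj c x) < scale c N) : y ∈ cylAt c x n := by
  obtain ⟨⟨i, hi1, hi2, hi3⟩, j, hj1, hj2, hj3⟩ := hx
  have h1 := rank_mul_scale_le_proj hc x N
  have h2 := proj_le_rank_add_one hc x N
  have h3 := rank_mul_scale_le_proj hc y n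
  have h4 := proj_le_rank_add_one hc y n
  have h5 := rank_gap_left hc x hi1 hi2 hi3
  have h6 := rank_gap_right hc x hj1 hj2 hj3
  rw [Real.dist_eq, abs_lt] at h
  have hs := scale_pos hc n
  have h7 : rank c x n < rank c y n + 1 := by
    have : (rank c x n : ℝ) < rank c y n + 1 := lt_of_mul_lt_mul_right (by linarith) hs.le
    exact_mod_cast this
  have h8 : rank c y n < rank c x n + 1 := by
    have : (rank c y n : ℝ) < rank c x n + 1 := lt_of_mul_lt_mul_right (by linarith) hs.le
    exact_mod_cast this
  exact mem_cylAt_of_rank_eq x y n (by omega)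

lemma continuous_proj : Continuous (proj c) := by
  refine continuous_tsum (fun n => ?_) (scale_summable hc) fun n x => ?_
  · have : Continuous fun x : SeqSpace c => x n := continuous_apply n
    exact ((continuous_of_discreteTopology (f := fun i : Fin (c n) =>
      (i.val : ℝ) * scale c (n + 1))).comp this)
  · rw [Real.norm_of_nonneg (digit_mul_scale_nonneg hc x n)]
    linarith [digit_mul_scale_le hc x n, scale_pos hc (n + 1)]

end Scale

/-! ### Bounds for Olsen's measures -/

/-- A mass distribution principle for Olsen's multifractal Hausdorff measure. -/
lemma Hmeas_ne_zero_of_mass {Ω : Type} [MeasurableSpace Ω] {Z : Type} [MetricSpace Z]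
    [MeasurableSpace Z] (m : Measure Z) (q t : ℝ) (lam : Measure Ω) (g : Ω → Z) (F : Set Ω)
    (hF : lam F ≠ 0) (C : ℝ≥0∞) (hC : C ≠ ∞) {r₀ : ℝ} (hr₀ : 0 < r₀)
    (h : ∀ x ∈ F, ∀ r, 0 < r → r < r₀ → lam (g ⁻¹' closedBall (g x) r) ≤
      C * (m (closedBall (g x) r) ^ q * ENNReal.ofReal (2 * r) ^ t))
    (E : Set Z) (hE : g '' F ⊆ E) : Hmeas m q t E ≠ 0 := by
  intro h0
  have h1 : Hpre m q t (g '' F) ≤ 0 := by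
    rw [← h0]; exact le_iSup₂_of_le (g '' F) hE le_rfl
  have h2 : Hdel m q t (r₀ / 2) (g '' F) ≤ 0 := by
    refine le_trans ?_ h1; exact le_iSup₂_of_le (r₀ / 2) (by linarith) le_rfl
  have h3 : lam F / C ≤ Hdel m q t (r₀ / 2) (g '' F) := by
    refine le_iInf fun ι => le_iInf fun hι => le_iInf fun z => le_iInf fun r => le_iInf fun hz =>
      le_iInf fun hr => le_iInf fun hcov => ?_
    refine ENNReal.div_le_of_le_mul' ?_
    calc lam F ≤ lam (⋃ i, g ⁻¹' closedBall (z i) (r i)) := by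
          refine measure_mono fun x hx => ?_
          have := hcov (mem_image_of_mem g hx)
          simpa using this
      _ ≤ ∑' i, lam (g ⁻¹' closedBall (z i) (r i)) := measure_iUnion_le _
      _ ≤ ∑' i, C * (m (closedBall (z i) (r i)) ^ q * ENNReal.ofReal (2 * r i) ^ t) := by
          refine ENNReal.tsum_le_tsum fun i => ?_
          obtain ⟨x, hx, hxz⟩ := hz i
          rw [← hxz]
          exact h x hx (r i) (hr i).1 (by linarith [(hr i).2])
      _ = C * olsenSum m q t z r := by rw [ENNReal.tsum_mul_left, olsenSum]
  have h4 : lam F / C = 0 := le_antisymm (h3.trans h2) zero_le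
  rcases ENNReal.div_eq_zero_iff.1 h4 with h5 | h5
  · exact hF h5
  · exact hC h5

lemma Hmeas_eq_zero_of_covers {Z : Type} [MetricSpace Z] [MeasurableSpace Z] (m : Measure Z)
    (q t : ℝ) (E : Set Z)
    (h : ∀ F ⊆ E, ∀ δ : ℝ, 0 < δ → ∀ ε : ℝ, 0 < ε → ∃ (ι : Type) (_ : Countable ι) (z : ι → Z)
      (r : ι → ℝ), (∀ i, z i ∈ F) ∧ (∀ i, 0 < r i ∧ r i ≤ δ) ∧
        (F ⊆ ⋃ i, closedBall (z i) (r i)) ∧ olsenSum m q t z r ≤ ENNReal.ofReal ε) :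
    Hmeas m q t E = 0 := by
  refine le_antisymm (iSup₂_le fun F hF => iSup₂_le fun δ hδ => ?_) zero_le
  refine ENNReal.le_of_forall_pos_le_add fun ε hε _ => ?_
  obtain ⟨ι, hι, z, r, hz, hr, hcov, hs⟩ := h F hF δ hδ ε (by exact_mod_cast hε)
  rw [zero_add]
  refine le_trans ?_ (hs.trans_eq (by simp))
  exact iInf_le_of_le ι <| iInf_le_of_le hι <| iInf_le_of_le z <| iInf_le_of_le r <|
    iInf_le_of_le hz <| iInf_le_of_le hr <| iInf_le _ hcov

lemma bFun_eq_of_threshold {Z : Type} [MetricSpace Z] [MeasurableSpace Z] (m : Measure Z)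
    (q θ : ℝ) (hlow : ∀ t < θ, Hmeas m q t (msupport m) ≠ 0)
    (hup : ∀ t, θ < t → Hmeas m q t (msupport m) = 0) : bFun m q = θ := by
  have hbdd : ∀ t ∈ {t | Hmeas m q t (msupport m) = 0}, θ ≤ t := fun t ht =>
    not_lt.1 fun hlt => hlow t hlt ht
  refine le_antisymm (le_of_forall_gt_imp_ge_of_dense fun t ht => ?_) ?_
  · exact csInf_le ⟨θ, hbdd⟩ (hup t ht)
  · exact le_csInf ⟨θ + 1, hup _ (by linarith)⟩ hbdd

/-! ### Product measures on sequence spaces -/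

lemma exists_product_measure {c : ℕ → ℕ} (w : ℕ → ℕ → ℝ) (hw : ∀ n i, i < c n → 0 ≤ w n i)
    (hsum : ∀ n, ∑ i ∈ Finset.range (c n), w n i = 1) :
    ∃ lam : Measure (SeqSpace c), IsProbabilityMeasure lam ∧
      ∀ (s : Finset ℕ) (x : SeqSpace c),
        lam {y | ∀ j ∈ s, y j = x j} = ENNReal.ofReal (∏ j ∈ s, w j (x j)) := by
  have h1 : ∀ n, ∑ i : Fin (c n), ENNReal.ofReal (w n i) = 1 := by
    intro n
    rw [← ENNReal.ofReal_sum_of_nonneg (f := fun i : Fin (c n) => w n i) fun i _ => hw n i i.isLt,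
      Fin.sum_univ_eq_sum_range (fun i => w n i) (c n), hsum, ENNReal.ofReal_one]
  let f : ∀ n, PMF (Fin (c n)) := fun n => PMF.ofFintype (fun i => ENNReal.ofReal (w n i)) (h1 n)
  refine ⟨Measure.infinitePi fun n => (f n).toMeasure, inferInstance, fun s x => ?_⟩
  have h2 : {y : SeqSpace c | ∀ j ∈ s, y j = x j} = Set.pi (s : Set ℕ) fun j => {x j} := by
    ext y; simp [Set.mem_pi]
  rw [h2, Measure.infinitePi_pi _ fun j _ => measurableSet_singleton _,
    ENNReal.ofReal_prod_of_nonneg fun j _ => hw j _ (x j).isLt]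
  refine Finset.prod_congr rfl fun j _ => ?_
  rw [PMF.toMeasure_apply_singleton _ _ (measurableSet_singleton _)]
  rfl

lemma summable_pow_div {ρ : ℝ} (h0 : 0 < ρ) (h1 : ρ < 1) {K : ℕ} (hK : 0 < K) :
    Summable fun N : ℕ => ρ ^ (N / K) := by
  set σ := ρ ^ (1 / (K : ℝ)) with hσ
  have hK' : (0 : ℝ) < K := by exact_mod_cast hK
  have hσ0 : 0 < σ := Real.rpow_pos_of_pos h0 _
  have hσ1 : σ < 1 := Real.rpow_lt_one h0.le h1 (by positivity)
  have hσK : σ ^ K = ρ := by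
    rw [hσ, ← Real.rpow_natCast, ← Real.rpow_mul h0.le, one_div, inv_mul_cancel₀ hK'.ne',
      Real.rpow_one]
  refine Summable.of_nonneg_of_le (fun N => by positivity) (fun N => ?_)
    ((summable_geometric_of_lt_one hσ0.le hσ1).mul_left ρ⁻¹)
  rw [inv_mul_eq_div, le_div_iff₀ h0, ← pow_succ, ← hσK, ← pow_mul]
  refine pow_le_pow_of_le_one hσ0.le hσ1.le ?_
  have := Nat.div_add_mod N K
  have := Nat.mod_lt N hK
  rw [Nat.mul_add_one]
  omega

lemma ae_eventually_mixedRun {c : ℕ → ℕ} (hc : ∀ n, 2 ≤ c n) {ρ : ℝ} (h0 : 0 < ρ) (h1 : ρ < 1)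
    {w : ℕ → ℕ → ℝ} (hw : ∀ n i, i < c n → 0 ≤ w n i ∧ w n i ≤ ρ)
    {lam : Measure (SeqSpace c)}
    (hlam : ∀ (s : Finset ℕ) (x : SeqSpace c),
      lam {y | ∀ j ∈ s, y j = x j} = ENNReal.ofReal (∏ j ∈ s, w j (x j)))
    {K : ℕ} (hK : 0 < K) :
    ∀ᵐ x ∂lam, ∀ᶠ N in atTop, MixedRun c x (N - N / K) N := by
  have hbox : ∀ (N : ℕ) (x : SeqSpace c),
      lam {y | ∀ j ∈ Finset.Ico (N - N / K) N, y j = x j} ≤ ENNReal.ofReal (ρ ^ (N / K)) := by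
    intro N x
    rw [hlam]
    refine ENNReal.ofReal_le_ofReal ?_
    refine (Finset.prod_le_prod (fun j _ => (hw j _ (x j).isLt).1)
      fun j _ => (hw j _ (x j).isLt).2).trans_eq ?_
    rw [Finset.prod_const, Nat.card_Ico, Nat.sub_sub_self (Nat.div_le_self N K)]
  have hbad : ∀ N, lam {x | ¬ MixedRun c x (N - N / K) N} ≤
      ENNReal.ofReal (2 * ρ ^ (N / K)) := by
    intro N
    let lo : SeqSpace c := fun n => ⟨0, by have := hc n; omega⟩
    let hi : SeqSpace c := fun n => ⟨c n - 1, by have := hc n; omega⟩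
    calc lam {x | ¬ MixedRun c x (N - N / K) N}
        ≤ lam ({y | ∀ j ∈ Finset.Ico (N - N / K) N, y j = lo j} ∪
            {y | ∀ j ∈ Finset.Ico (N - N / K) N, y j = hi j}) := by
          refine measure_mono fun x hx => ?_
          by_contra hcon
          simp only [mem_union, mem_ofPred_eq, not_or, not_forall, Finset.mem_Ico] at hcon
          obtain ⟨⟨i, ⟨hi1, hi2⟩, hi3⟩, j, ⟨hj1, hj2⟩, hj3⟩ := hcon
          refine hx ⟨⟨i, hi1, hi2, fun h => hi3 (Fin.ext h)⟩, j, hj1, hj2, fun h => hj3 (Fin.ext ?_)⟩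
          show (x j).val = c j - 1
          omega
      _ ≤ ENNReal.ofReal (ρ ^ (N / K)) + ENNReal.ofReal (ρ ^ (N / K)) :=
          (measure_union_le _ _).trans (add_le_add (hbox N lo) (hbox N hi))
      _ = ENNReal.ofReal (2 * ρ ^ (N / K)) := by
          rw [← ENNReal.ofReal_add (by positivity) (by positivity), two_mul]
  have hsum : ∑' N, lam {x | ¬ MixedRun c x (N - N / K) N} ≠ ∞ := by
    refine ne_top_of_le_ne_top ?_ (ENNReal.tsum_le_tsum hbad)
    exact ((summable_pow_div h0 h1 hK).mul_left 2).tsum_ofReal_ne_top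
  filter_upwards [ae_eventually_notMem hsum] with x hx
  filter_upwards [hx] with N hN
  simpa using hN

lemma exists_uniform_of_ae_eventually {Ω : Type} [MeasurableSpace Ω] {lam : Measure Ω}
    (hlam : lam univ ≠ 0) {Q : Ω → ℕ → Prop} (h : ∀ᵐ x ∂lam, ∀ᶠ N in atTop, Q x N) :
    ∃ n₀, lam {x | ∀ N, n₀ ≤ N → Q x N} ≠ 0 := by
  by_contra! hcon
  have h1 : lam (⋃ n₀, {x | ∀ N, n₀ ≤ N → Q x N}) = 0 := measure_iUnion_null hcon
  refine hlam (measure_mono_null (fun x _ => ?_) (measure_union_null h1 h))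
  by_cases hx : ∀ᶠ N in atTop, Q x N
  · obtain ⟨n₀, hn₀⟩ := eventually_atTop.1 hx
    exact Or.inl (mem_iUnion.2 ⟨n₀, hn₀⟩)
  · exact Or.inr hx

lemma mul_rpow_abs_le_rpow {P u y : ℝ} (s : ℝ) (hP : 0 < P) (hu : 0 < u) (hu1 : u ≤ 1)
    (h1 : P * u ≤ y) (h2 : y ≤ P) : P ^ s * u ^ |s| ≤ y ^ s := by
  have hy : 0 < y := (mul_pos hP hu).trans_le h1
  rcases le_or_gt 0 s with hs | hs
  · rw [abs_of_nonneg hs, ← Real.mul_rpow hP.le hu.le]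
    exact Real.rpow_le_rpow (mul_pos hP hu).le h1 hs
  · calc P ^ s * u ^ |s| ≤ P ^ s * 1 :=
          mul_le_mul_of_nonneg_left (Real.rpow_le_one hu.le hu1 (abs_nonneg s))
            (Real.rpow_nonneg hP.le s)
      _ = P ^ s := mul_one _
      _ ≤ y ^ s := Real.rpow_le_rpow_of_nonpos hy h2 hs.le

/-! ### Inhomogeneous multinomial measures -/

/-- `p` is a sequence of probability vectors on the alphabets `{0, …, c n - 1}`, whose sizes are
bounded by `M`, with entries bounded below by `η`. -/
structure IsWeights (c : ℕ → ℕ) (p : ℕ → ℕ → ℝ) (M : ℕ) (η : ℝ) : Prop where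
  two_le : ∀ n, 2 ≤ c n
  le_bound : ∀ n, c n ≤ M
  pos : 0 < η
  le_weight : ∀ n i, i < c n → η ≤ p n i
  sum_eq_one : ∀ n, ∑ i ∈ Finset.range (c n), p n i = 1

/-- The mass of the cylinder of generation `n` around `x`. -/
def mass (c : ℕ → ℕ) (p : ℕ → ℕ → ℝ) (x : SeqSpace c) (n : ℕ) : ℝ :=
  ∏ j ∈ Finset.range n, p j (x j)

/-- The moment of order `q` of the probability vector at position `n`. -/
def moment (c : ℕ → ℕ) (p : ℕ → ℕ → ℝ) (q : ℝ) (n : ℕ) : ℝ :=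
  ∑ i ∈ Finset.range (c n), p n i ^ q

namespace IsWeights

variable {c : ℕ → ℕ} {p : ℕ → ℕ → ℝ} {M : ℕ} {η : ℝ} (W : IsWeights c p M η)

include W

lemma weight_pos {n i : ℕ} (hi : i < c n) : 0 < p n i := W.pos.trans_le (W.le_weight n i hi)

lemma weight_le_one {n i : ℕ} (hi : i < c n) : p n i ≤ 1 := by
  rw [← W.sum_eq_one n]
  exact Finset.single_le_sum (f := fun i => p n i)
    (fun j hj => (W.weight_pos (Finset.mem_range.1 hj)).le) (Finset.mem_range.2 hi)

lemma eta_le_one : η ≤ 1 := by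
  have h : 0 < c 0 := by have := W.two_le 0; omega
  exact (W.le_weight 0 0 h).trans (W.weight_le_one h)

lemma one_le_bound : (1 : ℝ) ≤ M := by
  have h1 := W.two_le 0
  have h2 := W.le_bound 0
  exact_mod_cast (by omega : 1 ≤ M)

lemma mass_pos (x : SeqSpace c) (n : ℕ) : 0 < mass c p x n :=
  Finset.prod_pos fun j _ => W.weight_pos (x j).isLt

lemma mass_mul_pow_le (x : SeqSpace c) (n e : ℕ) :
    mass c p x n * η ^ e ≤ mass c p x (n + e) := by
  induction e with
  | zero => simp
  | succ e ih =>
    rw [← add_assoc, mass, mass, Finset.prod_range_succ, pow_succ, ← mul_assoc]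
    exact mul_le_mul ih (W.le_weight _ _ (x _).isLt) W.pos.le (W.mass_pos x _).le

lemma scale_le_bound_mul (n : ℕ) : scale c n ≤ M * scale c (n + 1) := by
  rw [← card_mul_scale_succ W.two_le n]
  have : (c n : ℝ) ≤ M := by exact_mod_cast W.le_bound n
  exact mul_le_mul_of_nonneg_right this (scale_pos W.two_le _).le

lemma scale_mul_pow_le (n e : ℕ) : scale c n * ((M : ℝ)⁻¹) ^ e ≤ scale c (n + e) := by
  have hM : (0 : ℝ) < M := zero_lt_one.trans_le W.one_le_bound
  induction e with
  | zero => simp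
  | succ e ih =>
    rw [← add_assoc, pow_succ, ← mul_assoc, mul_inv_le_iff₀ hM]
    linarith [W.scale_le_bound_mul (n + e)]

lemma weight_rpow_mem (q : ℝ) {n i : ℕ} (hi : i < c n) :
    η ^ |q| ≤ p n i ^ q ∧ p n i ^ q ≤ (η ^ |q|)⁻¹ := by
  have h1 := W.le_weight n i hi
  have h2 := W.weight_le_one hi
  have h3 := W.weight_pos hi
  constructor
  · have := mul_rpow_abs_le_rpow q one_pos W.pos W.eta_le_one (by rwa [one_mul]) h2
    simpa using this
  · have := mul_rpow_abs_le_rpow (-q) one_pos W.pos W.eta_le_one (by rwa [one_mul]) h2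
    rw [Real.one_rpow, one_mul, abs_neg, Real.rpow_neg h3.le] at this
    exact (le_inv_comm₀ (Real.rpow_pos_of_pos W.pos _) (Real.rpow_pos_of_pos h3 _)).1 this

lemma moment_pos (q : ℝ) (n : ℕ) : 0 < moment c p q n :=
  Finset.sum_pos (fun _ hi => Real.rpow_pos_of_pos (W.weight_pos (Finset.mem_range.1 hi)) q)
    ⟨0, Finset.mem_range.2 (by have := W.two_le n; omega)⟩

lemma moment_le (q : ℝ) (n : ℕ) : moment c p q n ≤ M * (η ^ |q|)⁻¹ := by
  have hη := Real.rpow_pos_of_pos W.pos |q|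
  calc moment c p q n ≤ ∑ _i ∈ Finset.range (c n), (η ^ |q|)⁻¹ :=
        Finset.sum_le_sum fun i hi => (W.weight_rpow_mem q (Finset.mem_range.1 hi)).2
    _ = c n * (η ^ |q|)⁻¹ := by rw [Finset.sum_const, Finset.card_range, nsmul_eq_mul]
    _ ≤ M * (η ^ |q|)⁻¹ :=
        mul_le_mul_of_nonneg_right (by exact_mod_cast W.le_bound n) (by positivity)

lemma weight_rpow_add_le_moment (q : ℝ) {n i : ℕ} (hi : i < c n) :
    p n i ^ q + η ^ |q| ≤ moment c p q n := by
  obtain ⟨j, hj, hij⟩ : ∃ j < c n, i ≠ j := by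
    have := W.two_le n
    rcases Nat.eq_zero_or_pos i with h | h
    · exact ⟨1, by omega, by omega⟩
    · exact ⟨0, by omega, by omega⟩
  calc p n i ^ q + η ^ |q| ≤ p n i ^ q + p n j ^ q := by
        linarith [(W.weight_rpow_mem q hj).1]
    _ = ∑ k ∈ {i, j}, p n k ^ q := by rw [Finset.sum_pair hij]
    _ ≤ moment c p q n := by
        refine Finset.sum_le_sum_of_subset_of_nonneg ?_ fun k hk _ =>
          Real.rpow_nonneg (W.weight_pos (Finset.mem_range.1 hk)).le q
        intro k hk
        simp only [Finset.mem_insert, Finset.mem_singleton] at hk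
        rcases hk with rfl | rfl <;> exact Finset.mem_range.2 ‹_›

lemma exists_gibbs_bound (q : ℝ) : ∃ ρ : ℝ, 0 < ρ ∧ ρ < 1 ∧
    ∀ n i, i < c n → 0 ≤ p n i ^ q / moment c p q n ∧ p n i ^ q / moment c p q n ≤ ρ := by
  have hη := Real.rpow_pos_of_pos W.pos |q|
  have hM := W.one_le_bound
  set B := M * (η ^ |q|)⁻¹ with hB
  have hB0 : 0 < B := by positivity
  have key : ∀ n i, i < c n → 0 < p n i ^ q / moment c p q n ∧
      p n i ^ q / moment c p q n ≤ 1 - η ^ |q| / B := by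
    intro n i hi
    have hS := W.moment_pos q n
    refine ⟨div_pos (Real.rpow_pos_of_pos (W.weight_pos hi) q) hS, ?_⟩
    calc p n i ^ q / moment c p q n ≤ (moment c p q n - η ^ |q|) / moment c p q n := by
          gcongr; linarith [W.weight_rpow_add_le_moment q hi]
      _ = 1 - η ^ |q| / moment c p q n := by rw [sub_div, div_self hS.ne']
      _ ≤ 1 - η ^ |q| / B := by
          gcongr; exact W.moment_le q n
  have h0 : 0 < c 0 := by have := W.two_le 0; omega
  refine ⟨1 - η ^ |q| / B, (key 0 0 h0).1.trans_le (key 0 0 h0).2, ?_, fun n i hi =>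
    ⟨(key n i hi).1.le, (key n i hi).2⟩⟩
  linarith [div_pos hη hB0]

lemma scale_rpow (t : ℝ) (n : ℕ) :
    scale c n ^ t = ∏ j ∈ Finset.range n, (c j : ℝ) ^ (-t) := by
  rw [scale, ← Real.finsetProd_rpow _ _ fun j _ => (inv_pos.2 (card_pos_real W.two_le j)).le]
  refine Finset.prod_congr rfl fun j _ => ?_
  rw [Real.inv_rpow (card_pos_real W.two_le j).le, Real.rpow_neg (card_pos_real W.two_le j).le]

lemma gibbs_mass_le {q θ : ℝ} (hθ : ∀ n, (c n : ℝ) ^ θ ≤ moment c p q n)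
    (x : SeqSpace c) (n : ℕ) :
    ∏ j ∈ Finset.range n, p j (x j) ^ q / moment c p q j ≤ mass c p x n ^ q * scale c n ^ θ := by
  rw [W.scale_rpow, mass, ← Real.finsetProd_rpow _ _ fun j _ => (W.weight_pos (x j).isLt).le,
    ← Finset.prod_mul_distrib]
  refine Finset.prod_le_prod (fun j _ => div_nonneg
    (Real.rpow_nonneg (W.weight_pos (x j).isLt).le q) (W.moment_pos q j).le) fun j _ => ?_
  rw [Real.rpow_neg (card_pos_real W.two_le j).le, ← div_eq_mul_inv]
  exact div_le_div_of_nonneg_left (Real.rpow_nonneg (W.weight_pos (x j).isLt).le q)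
    (Real.rpow_pos_of_pos (card_pos_real W.two_le j) θ) (hθ j)

/-- The comparison between Gibbs weights and the terms of Olsen's sums. -/
lemma gibbs_le_olsen_term {q t θ : ℝ} (ht : t < θ) :
    ∃ K : ℕ, 0 < K ∧ ∃ C : ℝ, 0 ≤ C ∧ ∀ (x : SeqSpace c) (N : ℕ) (r y : ℝ),
      scale c (N + 1) ≤ r → r < scale c N →
      mass c p x (N + 1) ≤ y → y ≤ mass c p x (N - N / K) →
      mass c p x (N - N / K) ^ q * scale c (N - N / K) ^ θ ≤ C * (y ^ q * (2 * r) ^ t) := by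
  have hM1 := W.one_le_bound
  have hM0 : (0 : ℝ) < M := zero_lt_one.trans_le hM1
  have hη := W.pos
  set G : ℝ := ((M : ℝ)⁻¹ ^ |θ| * η ^ |q|)⁻¹ with hG
  have hm : 0 < (M : ℝ)⁻¹ ^ |θ| := Real.rpow_pos_of_pos (inv_pos.2 hM0) _
  have hn : 0 < η ^ |q| := Real.rpow_pos_of_pos hη _
  have hG0 : 0 < G := by positivity
  have hG1 : 1 ≤ G := by
    rw [hG]
    refine (one_le_inv₀ (by positivity)).2 (mul_le_one₀ ?_ hn.le ?_)
    · exact Real.rpow_le_one (by positivity) (inv_le_one_of_one_le₀ hM1) (abs_nonneg _)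
    · exact Real.rpow_le_one hη.le W.eta_le_one (abs_nonneg _)
  set β : ℝ := (2 : ℝ) ^ (θ - t) with hβ
  have hβ1 : 1 < β := Real.one_lt_rpow (by norm_num) (by linarith)
  have hβ0 : 0 < β := zero_lt_one.trans hβ1
  obtain ⟨K, hK⟩ := pow_unbounded_of_one_lt G hβ1
  have hK' : G ≤ β ^ (K + 1) := hK.le.trans (pow_le_pow_right₀ hβ1.le K.le_succ)
  have hu0 : 0 < (2 * (M : ℝ))⁻¹ ^ |t| := Real.rpow_pos_of_pos (by positivity) _
  have hv0 : 0 < (2 * (M : ℝ)) ^ t := Real.rpow_pos_of_pos (by positivity) _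
  refine ⟨K + 1, K.succ_pos, G * ((2 * (M : ℝ)) ^ t * (2 * (M : ℝ))⁻¹ ^ |t|)⁻¹, by positivity, ?_⟩
  intro x N r y hr1 hr2 hy1 hy2
  set e := N / (K + 1) with he
  have heN : e ≤ N := Nat.div_le_self _ _
  set n := N - e with hne
  have hnN : N + 1 = n + (e + 1) := by omega
  set P := mass c p x n with hP
  have hP0 : 0 < P := W.mass_pos x n
  set D := scale c (N + 1) with hD
  have hD0 : 0 < D := scale_pos W.two_le _
  set D' := scale c n with hD'
  have hD'0 : 0 < D' := scale_pos W.two_le _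
  have hr0 : 0 < 2 * r := by linarith
  -- mass comparison
  have h1 : P ^ q * (η ^ |q|) ^ (e + 1) ≤ y ^ q := by
    rw [Real.rpow_pow_comm hη.le]
    refine mul_rpow_abs_le_rpow q hP0 (by positivity) (pow_le_one₀ hη.le W.eta_le_one) ?_ hy2
    refine le_trans ?_ hy1
    rw [hnN]
    exact W.mass_mul_pow_le x n (e + 1)
  -- scale comparison
  have h2 : D' ^ θ * ((M : ℝ)⁻¹ ^ |θ|) ^ (e + 1) ≤ D ^ θ := by
    rw [Real.rpow_pow_comm (by positivity)]
    refine mul_rpow_abs_le_rpow θ hD'0 (by positivity)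
      (pow_le_one₀ (by positivity) (inv_le_one_of_one_le₀ hM1)) ?_ ?_
    · rw [hD, hnN]
      exact W.scale_mul_pow_le n (e + 1)
    · exact (scale_strictAnti W.two_le).antitone (hnN ▸ Nat.le_add_right n (e + 1))
  have h3 : D ^ t * ((2 * (M : ℝ)) ^ t * (2 * (M : ℝ))⁻¹ ^ |t|) ≤ (2 * r) ^ t := by
    have := mul_rpow_abs_le_rpow (P := 2 * M * D) (u := (2 * (M : ℝ))⁻¹) (y := 2 * r) t
      (by positivity) (by positivity) (inv_le_one_of_one_le₀ (by linarith)) ?_ ?_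
    · rw [Real.mul_rpow (by positivity) hD0.le] at this
      linarith
    · field_simp
      linarith
    · have := W.scale_le_bound_mul N
      linarith
  have h4 : D ^ θ * β ^ N ≤ D ^ t := by
    have h5 : D ^ (θ - t) ≤ (β ^ N)⁻¹ := by
      have h6 : D ≤ (1 / 2 : ℝ) ^ N :=
        (scale_le_geometric W.two_le (N + 1)).trans
          (pow_le_pow_of_le_one (by norm_num) (by norm_num) N.le_succ)
      refine (Real.rpow_le_rpow hD0.le h6 (by linarith)).trans_eq ?_
      rw [hβ, ← Real.rpow_pow_comm (by norm_num), one_div, Real.inv_rpow (by norm_num), inv_pow]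
    calc D ^ θ * β ^ N = D ^ t * (D ^ (θ - t) * β ^ N) := by
          rw [← mul_assoc, ← Real.rpow_add hD0]; congr 2; ring
      _ ≤ D ^ t * 1 := by
          refine mul_le_mul_of_nonneg_left ?_ (Real.rpow_nonneg hD0.le t)
          rwa [← le_div_iff₀ (by positivity), one_div]
      _ = D ^ t := mul_one _
  have h7 : G ^ e ≤ β ^ N := by
    calc G ^ e ≤ (β ^ (K + 1)) ^ e := pow_le_pow_left₀ hG0.le hK' e
      _ = β ^ ((K + 1) * e) := (pow_mul _ _ _).symm
      _ ≤ β ^ N := pow_le_pow_right₀ hβ1.le (Nat.mul_div_le N (K + 1))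
  have hprod : P ^ q * D' ^ θ ≤ y ^ q * D ^ θ * G ^ (e + 1) := by
    have h8 : P ^ q * D' ^ θ * (G⁻¹) ^ (e + 1) ≤ y ^ q * D ^ θ := by
      rw [hG, inv_inv, mul_pow]
      calc P ^ q * D' ^ θ * (((M : ℝ)⁻¹ ^ |θ|) ^ (e + 1) * (η ^ |q|) ^ (e + 1))
          = (P ^ q * (η ^ |q|) ^ (e + 1)) * (D' ^ θ * ((M : ℝ)⁻¹ ^ |θ|) ^ (e + 1)) := by ring
        _ ≤ y ^ q * D ^ θ := mul_le_mul h1 h2 (by positivity) (le_trans (by positivity) h1)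
    rwa [inv_pow, ← div_eq_mul_inv, div_le_iff₀ (by positivity)] at h8
  have hyq : 0 ≤ y ^ q := le_trans (by positivity) h1
  calc P ^ q * D' ^ θ ≤ y ^ q * D ^ θ * G ^ (e + 1) := hprod
    _ = G * (y ^ q * (D ^ θ * G ^ e)) := by ring
    _ ≤ G * (y ^ q * (D ^ θ * β ^ N)) := by gcongr
    _ ≤ G * (y ^ q * D ^ t) := by gcongr
    _ ≤ G * (y ^ q * ((2 * r) ^ t * ((2 * (M : ℝ)) ^ t * (2 * (M : ℝ))⁻¹ ^ |t|)⁻¹)) := by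
        gcongr
        rwa [← div_eq_mul_inv, le_div_iff₀ (by positivity)]
    _ = _ := by ring

end IsWeights

/-! ### Olsen's function of a multinomial measure and of its images -/

/-- Two points whose cylinders of generation `n` have ranks differing by at most `2`. -/
def Near (c : ℕ → ℕ) (n : ℕ) (x y : SeqSpace c) : Prop :=
  rank c y n ≤ rank c x n + 2 ∧ rank c x n ≤ rank c y n + 2

lemma Near.symm {c : ℕ → ℕ} {n : ℕ} {x y : SeqSpace c} (h : Near c n x y) : Near c n y x :=
  ⟨h.2, h.1⟩

/-- The extension of a finite word by zeros. -/
def extend {c : ℕ → ℕ} (hc : ∀ n, 2 ≤ c n) (n : ℕ) (w : ∀ i : Fin n, Fin (c i)) : SeqSpace c :=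
  fun j => if h : j < n then w ⟨j, h⟩ else ⟨0, by have := hc j; omega⟩

lemma extend_apply {c : ℕ → ℕ} (hc : ∀ n, 2 ≤ c n) (n : ℕ) (w : ∀ i : Fin n, Fin (c i))
    (i : Fin n) : extend hc n w i = w i := by
  simp [extend]

lemma mem_cylAt_extend {c : ℕ → ℕ} (hc : ∀ n, 2 ≤ c n) (x : SeqSpace c) (n : ℕ) :
    x ∈ cylAt c (extend hc n fun i => x i) n := fun i hi => by
  simp [extend, hi]

lemma card_near_le {c : ℕ → ℕ} (hc : ∀ n, 2 ≤ c n) (n : ℕ) (x : SeqSpace c) :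
    (Finset.univ.filter fun w : ∀ i : Fin n, Fin (c i) =>
      Near c n x (extend hc n w)).card ≤ 5 := by
  have hinj : ∀ w v : ∀ i : Fin n, Fin (c i),
      rank c (extend hc n w) n = rank c (extend hc n v) n → w = v := by
    intro w v h
    funext i
    rw [← extend_apply hc n w i, ← extend_apply hc n v i]
    exact mem_cylAt_of_rank_eq _ _ n h i i.isLt
  rw [← Finset.card_image_of_injOn (f := fun w => rank c (extend hc n w) n)
    fun w _ v _ h => hinj w v h]
  refine (Finset.card_le_card (t := Finset.Icc (rank c x n - 2) (rank c x n + 2)) ?_).trans ?_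
  · intro k hk
    obtain ⟨w, hw, rfl⟩ := Finset.mem_image.1 hk
    have := (Finset.mem_filter.1 hw).2
    simp only [Near] at this
    rw [Finset.mem_Icc]
    omega
  · rw [Nat.card_Icc]
    omega

lemma rpow_le_const_mul_sum_rpow {ι : Type} (s : Finset ι) (f : ι → ℝ≥0∞) (hs : s.card ≤ 5)
    {A : ℝ≥0∞} (q : ℝ) {i₀ : ι} (hi₀ : i₀ ∈ s) (hA : f i₀ ≤ A) (hA' : A ≤ ∑ i ∈ s, f i) :
    A ^ q ≤ 5 ^ |q| * ∑ i ∈ s, f i ^ q := by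
  rcases le_or_gt 0 q with hq | hq
  · obtain ⟨j, hj, hmax⟩ := Finset.exists_max_image s f ⟨i₀, hi₀⟩
    have h1 : A ≤ 5 * f j := by
      refine hA'.trans ((Finset.sum_le_card_nsmul s f (f j) hmax).trans ?_)
      rw [nsmul_eq_mul]
      gcongr
      exact_mod_cast hs
    calc A ^ q ≤ (5 * f j) ^ q := ENNReal.rpow_le_rpow h1 hq
      _ = 5 ^ |q| * f j ^ q := by rw [ENNReal.mul_rpow_of_nonneg _ _ hq, abs_of_nonneg hq]
      _ ≤ 5 ^ |q| * ∑ i ∈ s, f i ^ q := by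
          gcongr
          exact Finset.single_le_sum (f := fun i => f i ^ q) (fun _ _ => zero_le) hj
  · calc A ^ q ≤ f i₀ ^ q := by
          rw [← neg_neg q, ENNReal.rpow_neg A, ENNReal.rpow_neg (f i₀), ENNReal.inv_le_inv]
          exact ENNReal.rpow_le_rpow hA (by linarith)
      _ ≤ ∑ i ∈ s, f i ^ q :=
          Finset.single_le_sum (f := fun i => f i ^ q) (fun _ _ => zero_le) hi₀
      _ ≤ 5 ^ |q| * ∑ i ∈ s, f i ^ q := by
          refine le_mul_of_one_le_left zero_le ?_
          exact ENNReal.one_le_rpow (by norm_num) (abs_pos.2 hq.ne)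

namespace IsWeights

variable {c : ℕ → ℕ} {p : ℕ → ℕ → ℝ} {M : ℕ} {η : ℝ} (W : IsWeights c p M η)

include W

lemma sum_mass_rpow (q : ℝ) (n : ℕ) :
    ∑ w : ∀ i : Fin n, Fin (c i), mass c p (extend W.two_le n w) n ^ q =
      ∏ j ∈ Finset.range n, moment c p q j := by
  have h1 : ∀ w : ∀ i : Fin n, Fin (c i), mass c p (extend W.two_le n w) n ^ q =
      ∏ i : Fin n, p i (w i) ^ q := by
    intro w
    rw [mass, ← Real.finsetProd_rpow _ _ fun j _ => (W.weight_pos (extend W.two_le n w j).isLt).le,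
      ← Fin.prod_univ_eq_prod_range (fun j => p j (extend W.two_le n w j) ^ q) n]
    simp only [extend_apply]
  rw [Finset.sum_congr rfl fun w _ => h1 w, ← Fin.prod_univ_eq_prod_range]
  have h2 : ∀ i : Fin n, moment c p q i = ∑ k : Fin (c i), p i k ^ q := fun i =>
    (Fin.sum_univ_eq_sum_range (fun k => p i k ^ q) (c i)).symm
  rw [Finset.prod_congr rfl fun i _ => h2 i, Finset.prod_univ_sum, Fintype.piFinset_univ]

variable {q θ : ℝ} {mu : Measure (SeqSpace c)}
  (hmu : ∀ x n, mu (cylAt c x n) = ENNReal.ofReal (mass c p x n))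
  {Z : Type} [MetricSpace Z] [MeasurableSpace Z] {m : Measure Z} {g : SeqSpace c → Z}
  (hm : ∀ x r, m (closedBall x r) = mu (g ⁻¹' closedBall x r))
  (hg : ∀ x y n, y ∈ cylAt c x n → dist (g y) (g x) ≤ scale c n)

include hmu hm hg

lemma ball_rpow_le (hnear : ∀ x y n, dist (g y) (g x) ≤ scale c n → Near c n x y)
    (x : SeqSpace c) (n : ℕ) :
    m (closedBall (g x) (scale c n)) ^ q ≤ 5 ^ |q| *
      ∑ w with Near c n x (extend W.two_le n w),
        ENNReal.ofReal (mass c p (extend W.two_le n w) n ^ q) := by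
  have hx := mem_cylAt_extend W.two_le x n
  have h1 : ∀ w, ENNReal.ofReal (mass c p (extend W.two_le n w) n ^ q) =
      mu (cylAt c (extend W.two_le n w) n) ^ q := fun w => by
    rw [hmu, ENNReal.ofReal_rpow_of_pos (W.mass_pos _ _)]
  simp_rw [h1]
  refine rpow_le_const_mul_sum_rpow _ (fun w => mu (cylAt c (extend W.two_le n w) n))
    (card_near_le W.two_le n x) q (i₀ := fun i => x i) ?_ ?_ ?_
  · have := rank_eq_of_mem_cylAt _ x n hx
    refine Finset.mem_filter.2 ⟨Finset.mem_univ _, ?_⟩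
    unfold Near
    omega
  · rw [hm]
    refine measure_mono fun y hy => mem_closedBall.2 (hg x y n fun i hi => ?_)
    rw [hy i hi, hx i hi]
  · rw [hm]
    refine (measure_mono fun y hy => ?_).trans (measure_biUnion_finset_le _ _)
    have hy' := mem_cylAt_extend W.two_le y n
    have hr := rank_eq_of_mem_cylAt _ y n hy'
    have hn := hnear x y n (mem_closedBall.1 hy)
    refine mem_iUnion₂.2 ⟨fun i => y i, ?_, hy'⟩
    refine Finset.mem_filter.2 ⟨Finset.mem_univ _, ?_⟩
    unfold Near at hn ⊢
    omega

lemma Hmeas_eq_zero {t : ℝ} (hsupp : msupport m = range g)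
    (hnear : ∀ x y n, dist (g y) (g x) ≤ scale c n → Near c n x y)
    (hθ : ∀ ε : ℝ, 0 < ε → ∀ n₀, ∃ n, n₀ ≤ n ∧
      ∏ j ∈ Finset.range n, (moment c p q j * (c j : ℝ) ^ (-t)) < ε) :
    Hmeas m q t (msupport m) = 0 := by
  refine Hmeas_eq_zero_of_covers m q t _ fun F hF δ hδ ε hε => ?_
  obtain ⟨n₀, hn₀⟩ := eventually_atTop.1 ((scale_tendsto W.two_le).eventually (gt_mem_nhds hδ))
  set A : ℝ := 5 ^ |q| * 5 * 2 ^ t with hA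
  have hA0 : 0 < A := by positivity
  obtain ⟨n, hn, hprod⟩ := hθ (ε / A) (by positivity) n₀
  have hD := scale_pos W.two_le n
  let ι := {w : ∀ i : Fin n, Fin (c i) // ∃ y ∈ cylAt c (extend W.two_le n w) n, g y ∈ F}
  choose y hy hyF using fun w : ι => w.2
  refine ⟨ι, inferInstance, fun w => g (y w), fun _ => scale c n, hyF, fun _ => ⟨hD, (hn₀ n hn).le⟩,
    fun z hz => ?_, ?_⟩
  · obtain ⟨x, rfl⟩ := (hsupp ▸ hF) hz
    have hx := mem_cylAt_extend W.two_le x n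
    refine mem_iUnion.2 ⟨⟨fun i => x i, x, hx, hz⟩, mem_closedBall.2 (hg _ _ n fun i hi => ?_)⟩
    rw [hx i hi]
    exact (hy ⟨fun i => x i, x, hx, hz⟩ i hi).symm
  · set h : (∀ i : Fin n, Fin (c i)) → ℝ≥0∞ := fun w =>
      ENNReal.ofReal (mass c p (extend W.two_le n w) n ^ q) with hh
    set B : ℝ≥0∞ := ENNReal.ofReal (2 * scale c n) ^ t with hB
    calc olsenSum m q t (fun w : ι => g (y w)) (fun _ => scale c n)
        ≤ ∑' w : ι, (5 ^ |q| * ∑ v with Near c n (extend W.two_le n w.1) (extend W.two_le n v),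
            h v) * B := by
          refine ENNReal.tsum_le_tsum fun w => mul_le_mul_left ?_ _
          have := W.ball_rpow_le (q := q) hmu hm hg hnear (y w) n
          simp only [Near, rank_eq_of_mem_cylAt _ _ n (hy w)] at this
          convert this
          exact Iff.rfl
      _ ≤ ∑' w : (∀ i : Fin n, Fin (c i)),
            (5 ^ |q| * ∑ v with Near c n (extend W.two_le n w) (extend W.two_le n v), h v) * B :=
          ENNReal.tsum_comp_le_tsum_of_injective Subtype.val_injective
            (fun w => (5 ^ |q| * ∑ v with Near c n (extend W.two_le n w) (extend W.two_le n v),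
              h v) * B)
      _ = 5 ^ |q| * (∑ w, ∑ v with Near c n (extend W.two_le n w) (extend W.two_le n v), h v)
            * B := by rw [tsum_fintype, ← Finset.sum_mul, Finset.mul_sum]
      _ = 5 ^ |q| * (∑ v, ∑ w with Near c n (extend W.two_le n v) (extend W.two_le n w), h v)
            * B := by
          congr 2
          refine Finset.sum_comm' fun w v => ?_
          simp only [Finset.mem_univ, Finset.mem_filter, true_and, and_true]
          exact ⟨Near.symm, Near.symm⟩
      _ ≤ 5 ^ |q| * (∑ v, 5 * h v) * B := by
          gcongr with v
          rw [Finset.sum_const, nsmul_eq_mul]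
          gcongr
          exact_mod_cast card_near_le W.two_le n _
      _ = ENNReal.ofReal (A * ∏ j ∈ Finset.range n, (moment c p q j * (c j : ℝ) ^ (-t))) := by
          rw [← Finset.mul_sum, hh, ← ENNReal.ofReal_sum_of_nonneg fun w _ =>
            Real.rpow_nonneg (W.mass_pos _ _).le q, W.sum_mass_rpow, hB,
            ENNReal.ofReal_rpow_of_pos (by positivity), Finset.prod_mul_distrib, ← W.scale_rpow,
            Real.mul_rpow (by norm_num) hD.le, hA]
          have h5 : (5 : ℝ≥0∞) = ENNReal.ofReal 5 := by simp
          have hP : 0 ≤ ∏ j ∈ Finset.range n, moment c p q j :=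
            Finset.prod_nonneg fun j _ => (W.moment_pos q j).le
          rw [h5, ENNReal.ofReal_rpow_of_pos (by norm_num), ← ENNReal.ofReal_mul (by norm_num),
            ← ENNReal.ofReal_mul (by positivity), ← ENNReal.ofReal_mul (by positivity)]
          congr 1
          ring
      _ ≤ ENNReal.ofReal ε := by
          refine ENNReal.ofReal_le_ofReal ?_
          rw [lt_div_iff₀ hA0] at hprod
          linarith

lemma Hmeas_ne_zero [IsFiniteMeasure mu] {t : ℝ} (ht : t < θ) (hsupp : msupport m = range g)
    (hrun : ∀ x y n N, n ≤ N → MixedRun c x n N → dist (g y) (g x) < scale c N → y ∈ cylAt c x n)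
    (hθ : ∀ n, (c n : ℝ) ^ θ ≤ moment c p q n) :
    Hmeas m q t (msupport m) ≠ 0 := by
  obtain ⟨ρ, hρ0, hρ1, hρ⟩ := W.exists_gibbs_bound q
  obtain ⟨lam, hprob, hlam⟩ := exists_product_measure
    (fun n i => p n i ^ q / moment c p q n) (fun n i hi => (hρ n i hi).1)
    (fun n => by rw [← Finset.sum_div]; exact div_self (W.moment_pos q n).ne')
  have hlamcyl : ∀ x n, lam (cylAt c x n) ≤
      ENNReal.ofReal (mass c p x n ^ q * scale c n ^ θ) := by
    intro x n
    have h1 : cylAt c x n = {y | ∀ j ∈ Finset.range n, y j = x j} := by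
      ext y; simp [cylAt]
    rw [h1, hlam]
    exact ENNReal.ofReal_le_ofReal (W.gibbs_mass_le hθ x n)
  obtain ⟨K, hK, C, hC, hterm⟩ := W.gibbs_le_olsen_term (q := q) ht
  obtain ⟨n₀, hn₀⟩ := exists_uniform_of_ae_eventually (lam := lam) (by simp)
    (ae_eventually_mixedRun W.two_le hρ0 hρ1 hρ hlam hK)
  refine Hmeas_ne_zero_of_mass m q t lam g _ hn₀ (ENNReal.ofReal C) ENNReal.ofReal_ne_top
    (scale_pos W.two_le n₀) (fun x hx r hr hr' => ?_) _ (hsupp ▸ image_subset_range g _)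
  obtain ⟨N, hN, hr1, hr2⟩ := exists_scale_le_lt W.two_le hr hr'
  have hsub : g ⁻¹' closedBall (g x) r ⊆ cylAt c x (N - N / K) := fun y hy =>
    hrun x y _ N (Nat.sub_le _ _) (hx N hN) ((mem_closedBall.1 hy).trans_lt hr2)
  have hsup : cylAt c x (N + 1) ⊆ g ⁻¹' closedBall (g x) r := fun y hy =>
    mem_closedBall.2 ((hg x y _ hy).trans hr1)
  have hmass := W.mass_pos x (N + 1)
  set y := (m (closedBall (g x) r)).toReal with hy
  have hy' : m (closedBall (g x) r) = ENNReal.ofReal y := by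
    rw [hy, ENNReal.ofReal_toReal]
    rw [hm]
    exact measure_ne_top mu _
  have hy1 : mass c p x (N + 1) ≤ y := by
    have := measure_mono (μ := mu) hsup
    rw [hmu, ← hm, hy'] at this
    by_contra! hcon
    exact absurd this (not_le.2 ((ENNReal.ofReal_lt_ofReal_iff hmass).2 hcon))
  have hy2 : y ≤ mass c p x (N - N / K) := by
    have := measure_mono (μ := mu) hsub
    rw [hmu, ← hm, hy'] at this
    exact (ENNReal.ofReal_le_ofReal_iff (W.mass_pos _ _).le).1 this
  rw [hy', ENNReal.ofReal_rpow_of_pos (hmass.trans_le hy1),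
    ENNReal.ofReal_rpow_of_pos (by linarith),
    ← ENNReal.ofReal_mul (Real.rpow_nonneg (hmass.trans_le hy1).le q), ← ENNReal.ofReal_mul hC]
  exact ((measure_mono hsub).trans (hlamcyl x _)).trans
    (ENNReal.ofReal_le_ofReal (hterm x N r y hr1 hr2 hy1 hy2))

theorem bFun_eq [IsFiniteMeasure mu] (hsupp : msupport m = range g)
    (hnear : ∀ x y n, dist (g y) (g x) ≤ scale c n → Near c n x y)
    (hrun : ∀ x y n N, n ≤ N → MixedRun c x n N → dist (g y) (g x) < scale c N → y ∈ cylAt c x n)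
    (hlow : ∀ n, (c n : ℝ) ^ θ ≤ moment c p q n)
    (hup : ∀ t, θ < t → ∀ ε : ℝ, 0 < ε → ∀ n₀, ∃ n, n₀ ≤ n ∧
      ∏ j ∈ Finset.range n, (moment c p q j * (c j : ℝ) ^ (-t)) < ε) :
    bFun m q = θ :=
  bFun_eq_of_threshold m q θ
    (fun _ ht => W.Hmeas_ne_zero hmu hm hg ht hsupp hrun hlow)
    (fun t ht => W.Hmeas_eq_zero hmu hm hg hsupp hnear (hup t ht))

end IsWeights

/-! ### Supports -/

lemma IsWeights.range_subset_msupport {c : ℕ → ℕ} {p : ℕ → ℕ → ℝ} {M : ℕ} {η : ℝ}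
    (W : IsWeights c p M η) {mu : Measure (SeqSpace c)}
    (hmu : ∀ x n, mu (cylAt c x n) = ENNReal.ofReal (mass c p x n))
    {Z : Type} [MetricSpace Z] [MeasurableSpace Z] {m : Measure Z} {g : SeqSpace c → Z}
    (hm : ∀ x r, m (closedBall x r) = mu (g ⁻¹' closedBall x r))
    (hg : ∀ x y n, y ∈ cylAt c x n → dist (g y) (g x) ≤ scale c n) :
    range g ⊆ msupport m := by
  rintro _ ⟨x, rfl⟩ r hr
  obtain ⟨n, hn⟩ := ((scale_tendsto W.two_le).eventually (gt_mem_nhds (half_pos hr))).exists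
  calc 0 < mu (cylAt c x n) := by
        rw [hmu]; exact ENNReal.ofReal_pos.2 (W.mass_pos x n)
    _ ≤ mu (g ⁻¹' closedBall (g x) (r / 2)) :=
        measure_mono fun y hy => mem_closedBall.2 ((hg x y n hy).trans hn.le)
    _ = m (closedBall (g x) (r / 2)) := (hm _ _).symm
    _ ≤ m (ball (g x) r) := measure_mono (closedBall_subset_ball (half_lt_self hr))

lemma msupport_map_subset_range {c : ℕ → ℕ} {mu : Measure (SeqSpace c)} {g : SeqSpace c → ℝ}
    (hg : Continuous g) : msupport (mu.map g) ⊆ range g := by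
  intro z hz
  by_contra hcon
  obtain ⟨r, hr, hball⟩ := Metric.isOpen_iff.1 (isCompact_range hg).isClosed.isOpen_compl z hcon
  have h1 : g ⁻¹' ball z r = ∅ := by
    refine eq_empty_of_forall_notMem fun x hx => hball hx (mem_range_self x)
  have h2 := hz r hr
  rw [Measure.map_apply hg.measurable measurableSet_ball, h1, measure_empty] at h2
  exact lt_irrefl _ h2

lemma mem_cylAt_iff_dist_le {c : ℕ → ℕ} (hc : ∀ n, 2 ≤ c n) [MetricSpace (SeqSpace c)]
    (hdist : ∀ (x y : SeqSpace c) (n : ℕ), (∀ i, i < n → x i = y i) → x n ≠ y n →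
      dist x y = scale c n) (x y : SeqSpace c) (n : ℕ) :
    y ∈ cylAt c x n ↔ dist y x ≤ scale c n := by
  by_cases hxy : y = x
  · subst hxy
    simp [self_mem_cylAt, (scale_pos hc n).le]
  · have hex : ∃ k, y k ≠ x k := by
      by_contra! hcon
      exact hxy (funext hcon)
    have hlt : ∀ i, i < Nat.find hex → y i = x i := fun i hi => not_not.1 (Nat.find_min hex hi)
    rw [hdist y x _ hlt (Nat.find_spec hex), (scale_strictAnti hc).le_iff_ge]
    constructor
    · intro h
      by_contra! hcon
      exact Nat.find_spec hex (h _ hcon)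
    · exact fun h i hi => hlt i (hi.trans_le h)

/-! ### Two alternating alphabets -/

/-- The weights `a` on the blocks of the first alphabet and `b` on those of the second one. -/
def altWeight (T : ℕ → ℕ) (a b : ℕ → ℝ) (n i : ℕ) : ℝ := if isA T (n + 1) then a i else b i

lemma Ncount_succ (T : ℕ → ℕ) (n : ℕ) :
    Ncount T (n + 1) = Ncount T n + if isA T (n + 1) then 1 else 0 := by
  unfold Ncount
  rw [← Finset.insert_Icc_right_eq_Icc_add_one (by omega : 1 ≤ n + 1), Finset.filter_insert]
  split_ifs with h
  · rw [Finset.card_insert_of_notMem (by simp)]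
  · rfl

lemma Ncount_le (T : ℕ → ℕ) (n : ℕ) : Ncount T n ≤ n :=
  (Finset.card_filter_le _ _).trans (by simp)

lemma Dw_eq_scale (c₁ c₂ : ℕ) (T : ℕ → ℕ) (n : ℕ) :
    Dw c₁ c₂ T n = scale (Yc c₁ c₂ T) n := by
  induction n with
  | zero => simp [Dw, scale, Ncount]
  | succ n ih =>
    have hle := Ncount_le T n
    rw [scale_succ, ← ih, Dw, Dw, Ncount_succ, ← mul_inv]
    congr 1
    unfold Yc
    split_ifs with h
    · rw [pow_succ, Nat.add_sub_add_right]
      ring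
    · rw [add_zero, Nat.succ_sub hle, pow_succ]
      ring

lemma gammaMap_eq_proj (c₁ c₂ : ℕ) (T : ℕ → ℕ) :
    gammaMap c₁ c₂ T = proj (Yc c₁ c₂ T) := by
  funext x
  simp only [gammaMap, proj, Dw_eq_scale]

lemma measure_cylAt_eq {c₁ c₂ : ℕ} {T : ℕ → ℕ} {a b : ℕ → ℝ} {μ : Measure (Omg c₁ c₂ T)}
    (hμ : ∀ (n : ℕ) (w : Word c₁ c₂ T n),
      μ (cyl c₁ c₂ T n w) = ENNReal.ofReal (cylWeight c₁ c₂ T a b n w))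
    (x : SeqSpace (Yc c₁ c₂ T)) (n : ℕ) :
    μ (cylAt (Yc c₁ c₂ T) x n) = ENNReal.ofReal (mass (Yc c₁ c₂ T) (altWeight T a b) x n) := by
  have h1 : cylAt (Yc c₁ c₂ T) x n = cyl c₁ c₂ T n fun i => x i := by
    ext y; simp [cylAt, cyl, Fin.forall_iff]
  rw [h1, hμ, mass, ← Fin.prod_univ_eq_prod_range (fun j => altWeight T a b j (x j))]
  rfl

lemma exists_pos_le_of_lt (f : ℕ → ℝ) (n : ℕ) (hf : ∀ i, i < n → 0 < f i) :
    ∃ η, 0 < η ∧ ∀ i, i < n → η ≤ f i := by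
  induction n with
  | zero => exact ⟨1, one_pos, fun i hi => absurd hi (Nat.not_lt_zero i)⟩
  | succ n ih =>
    obtain ⟨η, h0, h1⟩ := ih fun i hi => hf i (hi.trans n.lt_succ_self)
    refine ⟨min η (f n), lt_min h0 (hf n n.lt_succ_self), fun i hi => ?_⟩
    rcases Nat.lt_succ_iff_lt_or_eq.1 hi with h | rfl
    · exact (min_le_left _ _).trans (h1 i h)
    · exact min_le_right _ _

section Alternating

variable {c₁ c₂ : ℕ} (hc₁ : 2 ≤ c₁) (hc₂ : 2 ≤ c₂)

include hc₁ hc₂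

lemma exists_isWeights (T : ℕ → ℕ) {a b : ℕ → ℝ} (ha : ∀ i, i < c₁ → 0 < a i)
    (hb : ∀ j, j < c₂ → 0 < b j)
    (hsa : ∑ i ∈ Finset.range c₁, a i = 1) (hsb : ∑ j ∈ Finset.range c₂, b j = 1) :
    ∃ η, IsWeights (Yc c₁ c₂ T) (altWeight T a b) (max c₁ c₂) η := by
  obtain ⟨η₁, h1, h1'⟩ := exists_pos_le_of_lt a c₁ ha
  obtain ⟨η₂, h2, h2'⟩ := exists_pos_le_of_lt b c₂ hb
  refine ⟨min η₁ η₂, fun n => ?_, fun n => ?_, lt_min h1 h2, fun n i hi => ?_, fun n => ?_⟩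
  · unfold Yc; split_ifs <;> assumption
  · unfold Yc; split_ifs
    · exact le_max_left _ _
    · exact le_max_right _ _
  · unfold Yc at hi
    unfold altWeight
    split_ifs at hi ⊢ with h
    · exact (min_le_left _ _).trans (h1' i hi)
    · exact (min_le_right _ _).trans (h2' i hi)
  · unfold Yc altWeight
    split_ifs <;> assumption

omit hc₂ in
lemma rpow_theta {a : ℕ → ℝ} (ha : ∀ i, i < c₁ → 0 < a i) (q : ℝ) :
    (c₁ : ℝ) ^ theta c₁ a q = ∑ i ∈ Finset.range c₁, a i ^ q := by
  have h : (2 : ℝ) ≤ c₁ := by exact_mod_cast hc₁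
  refine Real.rpow_logb (by linarith) (by linarith) ?_
  exact Finset.sum_pos (fun i hi => Real.rpow_pos_of_pos (ha i (Finset.mem_range.1 hi)) q)
    ⟨0, Finset.mem_range.2 (by omega)⟩

lemma moment_alternating (T : ℕ → ℕ) {a b : ℕ → ℝ} (ha : ∀ i, i < c₁ → 0 < a i)
    (hb : ∀ j, j < c₂ → 0 < b j) (q : ℝ) (n : ℕ) :
    moment (Yc c₁ c₂ T) (altWeight T a b) q n =
      if isA T (n + 1) then (c₁ : ℝ) ^ theta c₁ a q else (c₂ : ℝ) ^ theta c₂ b q := by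
  rw [rpow_theta hc₁ ha, rpow_theta hc₂ hb]
  unfold moment Yc altWeight
  split_ifs <;> rfl

lemma rpow_min_theta_le_moment (T : ℕ → ℕ) {a b : ℕ → ℝ} (ha : ∀ i, i < c₁ → 0 < a i)
    (hb : ∀ j, j < c₂ → 0 < b j) (q : ℝ) (n : ℕ) :
    (Yc c₁ c₂ T n : ℝ) ^ min (theta c₁ a q) (theta c₂ b q) ≤
      moment (Yc c₁ c₂ T) (altWeight T a b) q n := by
  rw [moment_alternating hc₁ hc₂ T ha hb]
  unfold Yc
  split_ifs
  · exact Real.rpow_le_rpow_of_exponent_le (by exact_mod_cast (by omega : 1 ≤ c₁)) (min_le_left _ _)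
  · exact Real.rpow_le_rpow_of_exponent_le (by exact_mod_cast (by omega : 1 ≤ c₂)) (min_le_right _ _)

end Alternating

/-- Long stretches on which the factors are at most `α < 1` make the partial products small. -/
lemma exists_prod_lt_of_stretches {f : ℕ → ℝ} (hf : ∀ n, 0 ≤ f n) {α β : ℝ} (hα0 : 0 < α)
    (hα1 : α < 1) (hβ : ∀ n, f n ≤ β) {U V : ℕ → ℕ} (hU : Tendsto U atTop atTop)
    (hUV : ∀ L : ℕ, ∀ᶠ k in atTop, L * U k ≤ V k)
    (hfα : ∀ k n, U k ≤ n → n < V k → f n ≤ α) {ε : ℝ} (hε : 0 < ε) (n₀ : ℕ) :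
    ∃ n, n₀ ≤ n ∧ ∏ j ∈ Finset.range n, f j < ε := by
  set B := max 1 β with hB
  have hB0 : 0 < B := zero_lt_one.trans_le (le_max_left _ _)
  obtain ⟨L, hL⟩ := exists_pow_lt_of_lt_one (div_pos hα0 hB0) hα1
  have hαU : ∀ᶠ k in atTop, α ^ U k < ε :=
    ((tendsto_pow_atTop_nhds_zero_of_lt_one hα0.le hα1).comp hU).eventually (gt_mem_nhds hε)
  obtain ⟨k, hk1, hk2, hk3⟩ :=
    ((hUV (L + 1)).and (hαU.and (hU.eventually_ge_atTop n₀))).exists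
  have hle : U k + L * U k ≤ V k := by linarith
  have hUV' : U k ≤ V k := by omega
  refine ⟨V k, hk3.trans hUV', ?_⟩
  calc ∏ j ∈ Finset.range (V k), f j
      = (∏ j ∈ Finset.range (U k), f j) * ∏ j ∈ Finset.Ico (U k) (V k), f j :=
        (Finset.prod_range_mul_prod_Ico f hUV').symm
    _ ≤ (∏ _j ∈ Finset.range (U k), B) * ∏ _j ∈ Finset.Ico (U k) (V k), α := by
        refine mul_le_mul ?_ ?_ (Finset.prod_nonneg fun j _ => hf j) (by positivity)
        · exact Finset.prod_le_prod (fun j _ => hf j) fun j _ => (hβ j).trans (le_max_right _ _)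
        · refine Finset.prod_le_prod (fun j _ => hf j) fun j hj => ?_
          exact hfα k j (Finset.mem_Ico.1 hj).1 (Finset.mem_Ico.1 hj).2
    _ = B ^ U k * α ^ (V k - U k) := by simp
    _ ≤ B ^ U k * α ^ (L * U k) :=
        mul_le_mul_of_nonneg_left (pow_le_pow_of_le_one hα0.le hα1.le (by omega)) (by positivity)
    _ = (B * α ^ L) ^ U k := by rw [pow_mul, mul_pow]
    _ ≤ α ^ U k := by
        refine pow_le_pow_left₀ (by positivity) ?_ _
        rw [lt_div_iff₀ hB0] at hL
        linarith
    _ < ε := hk2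

section Blocks

variable {T : ℕ → ℕ} (hT1 : T 1 = 1) (hTmono : ∀ k, 1 ≤ k → T k < T (k + 1))

include hTmono

lemma block_mono {i j : ℕ} (hi : 1 ≤ i) (hij : i ≤ j) : T i ≤ T j := by
  induction j, hij using Nat.le_induction with
  | base => exact le_rfl
  | succ j hj ih => exact ih.trans (hTmono j (hi.trans hj)).le

lemma not_isA_of_mem_block {k j : ℕ} (hk : 1 ≤ k) (h1 : T (2 * k) ≤ j) (h2 : j < T (2 * k + 1)) :
    ¬ isA T j := by
  rintro ⟨l, hl, hl1, hl2⟩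
  rcases le_or_gt l k with h | h
  · have := block_mono hTmono (i := 2 * l) (j := 2 * k) (by omega) (by omega)
    omega
  · have := block_mono hTmono (i := 2 * k + 1) (j := 2 * l - 1) (by omega) (by omega)
    omega

include hT1

lemma le_block {k : ℕ} (hk : 1 ≤ k) : k ≤ T k := by
  induction k, hk using Nat.le_induction with
  | base => exact hT1.ge
  | succ k hk ih => exact Nat.succ_le_of_lt (ih.trans_lt (hTmono k hk))

lemma block_tendsto : Tendsto T atTop atTop :=
  tendsto_atTop_mono' _ ((eventually_ge_atTop 1).mono fun _ hk => le_block hT1 hTmono hk)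
    tendsto_id

lemma eventually_mul_block_le (hTrat : Tendsto (fun k => (T (k + 1) : ℝ) / (T k : ℝ)) atTop atTop)
    (L : ℕ) : ∀ᶠ k in atTop, L * T k ≤ T (k + 1) - 1 := by
  filter_upwards [hTrat.eventually_ge_atTop ((L : ℝ) + 1), eventually_ge_atTop 1] with k hk hk1
  have h1 : 1 ≤ T k := hk1.trans (le_block hT1 hTmono hk1)
  have h2 : (0 : ℝ) < T k := by exact_mod_cast h1
  rw [le_div_iff₀ h2] at hk
  have h3 : (L + 1) * T k ≤ T (k + 1) := by exact_mod_cast hk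
  have h4 : (L + 1) * T k = L * T k + T k := by ring
  omega

lemma exists_prod_moment_lt {c₁ c₂ : ℕ} (hc₁ : 2 ≤ c₁) (hc₂ : 2 ≤ c₂)
    (hTrat : Tendsto (fun k => (T (k + 1) : ℝ) / (T k : ℝ)) atTop atTop)
    {a b : ℕ → ℝ} (ha : ∀ i, i < c₁ → 0 < a i) (hb : ∀ j, j < c₂ → 0 < b j) (q : ℝ) {t : ℝ}
    (ht : min (theta c₁ a q) (theta c₂ b q) < t) (ε : ℝ) (hε : 0 < ε) (n₀ : ℕ) :
    ∃ n, n₀ ≤ n ∧ ∏ j ∈ Finset.range n, (moment (Yc c₁ c₂ T) (altWeight T a b) q j *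
      (Yc c₁ c₂ T j : ℝ) ^ (-t)) < ε := by
  have h1 : (1 : ℝ) < c₁ := by exact_mod_cast (by omega : 1 < c₁)
  have h2 : (1 : ℝ) < c₂ := by exact_mod_cast (by omega : 1 < c₂)
  have h10 : (0 : ℝ) < c₁ := by linarith
  have h20 : (0 : ℝ) < c₂ := by linarith
  have hf : ∀ n, moment (Yc c₁ c₂ T) (altWeight T a b) q n * (Yc c₁ c₂ T n : ℝ) ^ (-t) =
      if isA T (n + 1) then (c₁ : ℝ) ^ (theta c₁ a q - t) else (c₂ : ℝ) ^ (theta c₂ b q - t) := by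
    intro n
    rw [moment_alternating hc₁ hc₂ T ha hb]
    unfold Yc
    split_ifs
    · rw [← Real.rpow_add h10, sub_eq_add_neg]
    · rw [← Real.rpow_add h20, sub_eq_add_neg]
  simp only [hf]
  have hA := Real.rpow_pos_of_pos h10 (theta c₁ a q - t)
  have hB := Real.rpow_pos_of_pos h20 (theta c₂ b q - t)
  have hnonneg : ∀ n, 0 ≤ if isA T (n + 1) then (c₁ : ℝ) ^ (theta c₁ a q - t)
      else (c₂ : ℝ) ^ (theta c₂ b q - t) := fun n => by
    split_ifs
    · exact hA.le
    · exact hB.le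
  have hbound : ∀ n, (if isA T (n + 1) then (c₁ : ℝ) ^ (theta c₁ a q - t)
      else (c₂ : ℝ) ^ (theta c₂ b q - t)) ≤
        max ((c₁ : ℝ) ^ (theta c₁ a q - t)) ((c₂ : ℝ) ^ (theta c₂ b q - t)) := fun n => by
    split_ifs
    · exact le_max_left _ _
    · exact le_max_right _ _
  have hodd : Tendsto (fun k : ℕ => 2 * k + 1) atTop atTop :=
    tendsto_atTop_mono (fun k => by show k ≤ _; omega) tendsto_id
  have heven : Tendsto (fun k : ℕ => 2 * (k + 1)) atTop atTop :=
    tendsto_atTop_mono (fun k => by show k ≤ _; omega) tendsto_id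
  rcases min_lt_iff.1 ht with h | h
  · refine exists_prod_lt_of_stretches hnonneg hA
      (Real.rpow_lt_one_of_one_lt_of_neg h1 (by linarith)) hbound
      ((block_tendsto hT1 hTmono).comp hodd)
      (fun L => hodd.eventually (eventually_mul_block_le hT1 hTmono hTrat L))
      (fun k n hn1 hn2 => ?_) hε n₀
    simp only [Function.comp_apply] at hn1
    rw [if_pos ⟨k + 1, by omega, by
      rw [show 2 * (k + 1) - 1 = 2 * k + 1 by omega]; omega, by
      rw [show 2 * (k + 1) = 2 * k + 1 + 1 by ring]; omega⟩]
  · refine exists_prod_lt_of_stretches hnonneg hB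
      (Real.rpow_lt_one_of_one_lt_of_neg h2 (by linarith)) hbound
      ((block_tendsto hT1 hTmono).comp heven)
      (fun L => heven.eventually (eventually_mul_block_le hT1 hTmono hTrat L))
      (fun k n hn1 hn2 => ?_) hε n₀
    simp only [Function.comp_apply] at hn1
    rw [if_neg (not_isA_of_mem_block hTmono (k := k + 1) (by omega) (by omega) (by omega))]

end Blocks

/-- `b_ν(q) = b_μ(q) = min(θ_a(q), θ_b(q))`. -/
theorem stmt5 (c₁ c₂ : ℕ) (hc₁ : 2 ≤ c₁) (hc₂ : 2 ≤ c₂)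
    (T : ℕ → ℕ) (hT1 : T 1 = 1) (hTmono : ∀ k, 1 ≤ k → T k < T (k + 1))
    (hTrat : Tendsto (fun k => (T (k + 1) : ℝ) / (T k : ℝ)) atTop atTop)
    (a b : ℕ → ℝ) (ha : ∀ i, i < c₁ → 0 < a i ∧ a i < 1)
    (hb : ∀ j, j < c₂ → 0 < b j ∧ b j < 1)
    (hsa : ∑ i ∈ Finset.range c₁, a i = 1) (hsb : ∑ j ∈ Finset.range c₂, b j = 1)
    [MetricSpace (Omg c₁ c₂ T)]
    (hdist : ∀ (x y : Omg c₁ c₂ T) (n : ℕ), (∀ i, i < n → x i = y i) → x n ≠ y n →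
      dist x y = Dw c₁ c₂ T n)
    (μ : Measure (Omg c₁ c₂ T)) [IsProbabilityMeasure μ]
    (hμ : ∀ (n : ℕ) (w : Word c₁ c₂ T n),
      μ (cyl c₁ c₂ T n w) = ENNReal.ofReal (cylWeight c₁ c₂ T a b n w))
    (q : ℝ) :
    bFun (μ.map (gammaMap c₁ c₂ T)) q = bFun μ q ∧
    bFun μ q = min (theta c₁ a q) (theta c₂ b q) := by
  obtain ⟨η, W⟩ := exists_isWeights hc₁ hc₂ T (fun i hi => (ha i hi).1) (fun j hj => (hb j hj).1)
    hsa hsb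
  have hmu := measure_cylAt_eq hμ
  have hlow := rpow_min_theta_le_moment hc₁ hc₂ T (fun i hi => (ha i hi).1)
    (fun j hj => (hb j hj).1) q
  have hup := fun (t : ℝ) (ht : min (theta c₁ a q) (theta c₂ b q) < t) =>
    exists_prod_moment_lt (t := t) hT1 hTmono hc₁ hc₂ hTrat
    (fun i hi => (ha i hi).1) (fun j hj => (hb j hj).1) q ht
  have hsymb : bFun μ q = min (theta c₁ a q) (theta c₂ b q) := by
    have hdist' : ∀ (x y : Omg c₁ c₂ T) (n : ℕ), (∀ i, i < n → x i = y i) → x n ≠ y n →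
        dist x y = scale (Yc c₁ c₂ T) n := fun x y n h h' => by
      rw [hdist x y n h h', Dw_eq_scale]
    have hmem := fun x y n => mem_cylAt_iff_dist_le W.two_le hdist' x y n
    have hg : ∀ (x y : Omg c₁ c₂ T) n, y ∈ cylAt (Yc c₁ c₂ T) x n →
        dist (id y) (id x) ≤ scale (Yc c₁ c₂ T) n := fun x y n h => (hmem x y n).1 h
    refine W.bFun_eq (g := id) hmu (fun _ _ => rfl) hg ?_ (fun x y n h => ?_)
      (fun x y n N hnN _ h => ?_) hlow hup
    · refine Subset.antisymm (by simp) ?_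
      exact W.range_subset_msupport hmu (fun _ _ => rfl) hg
    · have := rank_eq_of_mem_cylAt _ y n ((hmem x y n).2 h)
      unfold Near
      omega
    · exact cylAt_anti _ x hnN ((hmem x y N).2 h.le)
  refine ⟨?_, hsymb⟩
  rw [hsymb, gammaMap_eq_proj]
  have hcont := continuous_proj W.two_le
  have hm : ∀ x r, μ.map (proj (Yc c₁ c₂ T)) (closedBall x r) =
      μ (proj (Yc c₁ c₂ T) ⁻¹' closedBall x r) := fun x r =>
    Measure.map_apply hcont.measurable measurableSet_closedBall
  have hg := dist_proj_le W.two_le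
  refine W.bFun_eq hmu hm hg ?_ (rank_near_of_dist_proj_le W.two_le)
    (fun x y n N _ hx h => mem_cylAt_of_dist_proj_lt W.two_le x y hx h) hlow hup
  exact Subset.antisymm (msupport_map_subset_range hcont) (W.range_subset_msupport hmu hm hg)

end MF
end
end
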